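/- arXiv:cond-mat/9712219 — 2 statements merged into one kernel-verified Lean document; each statement's English description precedes it below -/
import Mathlib

section
/- Let N_s ≥ 4 be even, let N_e be odd with N_s/2 < N_e < N_s, and let t > 0 and t' > 0. For each n ∈ {0,...,N_e}, the restriction of the limiting U–V Hamiltonian M to the n-th magnetization sector has a simple smallest eigenvalue E_n (its lowest eigenspace is one-dimensional), and these values coincide: E_0 = E_1 = ... = E_{N_e}. In particular the ground-state eigenspace of M has dimension exactly N_e + 1, with exactly one ground state in each magnetization sector. (This is Theorem 7.3: the ground states of the limiting U–V model in the limits U → ∞ and V → ∞ have total spin S_max = N_e/2 and are nondegenerate apart from the trivial (2S_max+1)-fold degeneracy.) -/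
/-- A configuration of the chain `ℤ/N_sℤ`: each site is empty (`none`), or carries an
up spin (`some true`) or a down spin (`some false`). -/
abbrev ChainCfg (Ns : ℕ) := ZMod Ns → Option Bool

/-- The number of occupied sites of a configuration. -/
def occNum {Ns : ℕ} [NeZero Ns] (ω : ChainCfg Ns) : ℕ :=
  (Finset.univ.filter fun x : ZMod Ns => ω x ≠ none).card

/-- The number of up spins of a configuration. -/
def upNum {Ns : ℕ} [NeZero Ns] (ω : ChainCfg Ns) : ℕ :=
  (Finset.univ.filter fun x : ZMod Ns => ω x = some true).card

/-- `ω'` is obtained from `ω` by moving the spin at some site to an empty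
cyclically-nearest-neighbour site. -/
def NNHop {Ns : ℕ} (ω ω' : ChainCfg Ns) : Prop :=
  ∃ x : ZMod Ns,
    (ω x ≠ none ∧ ω (x + 1) = none ∧
      ω' = Function.update (Function.update ω x none) (x + 1) (ω x)) ∨
    (ω (x + 1) ≠ none ∧ ω x = none ∧
      ω' = Function.update (Function.update ω (x + 1) none) x (ω (x + 1)))

/-- `ω'` is obtained from `ω` by moving the spin at an even site `2j` to the empty even
site `2j + 2`, or back (in an allowed configuration the intermediate site `2j + 1` is
automatically occupied). -/
def EvenNNNHop {Ns : ℕ} [NeZero Ns] (ω ω' : ChainCfg Ns) : Prop :=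
  ∃ x : ZMod Ns, x.val % 2 = 0 ∧
    ((ω x ≠ none ∧ ω (x + 2) = none ∧
      ω' = Function.update (Function.update ω x none) (x + 2) (ω x)) ∨
     (ω (x + 2) ≠ none ∧ ω x = none ∧
      ω' = Function.update (Function.update ω (x + 2) none) x (ω (x + 2))))

/-- Allowed configurations of the limiting `U`-`V` model: exactly `Ne` electrons and no
two cyclically adjacent empty sites (these minimize both the on-site and the
nearest-neighbour repulsion in the limits `U, V → ∞`). -/
abbrev AllowedCfg (Ns Ne : ℕ) [NeZero Ns] :=
  {ω : ChainCfg Ns // occNum ω = Ne ∧ ∀ x : ZMod Ns, ¬(ω x = none ∧ ω (x + 1) = none)}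

open Classical in
/-- The limiting `U`-`V` Hamiltonian of Section 7.4 (Hamiltonian (7.6) in the limits
`U, V → ∞`), written in the ordered position–spin basis of the allowed configurations:
entry `-t` for nearest-neighbour hops, `-t'` for next-nearest-neighbour hops between
even sites (the sign incorporating the fermionic exchange with the occupied
intermediate site), and all other entries `0`. -/
noncomputable def limUVHam (Ns Ne : ℕ) [NeZero Ns] (t t' : ℝ) :
    Matrix (AllowedCfg Ns Ne) (AllowedCfg Ns Ne) ℝ :=
  fun ω' ω =>
    if NNHop ω.1 ω'.1 then -t
    else if EvenNNNHop ω.1 ω'.1 then -t'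
    else 0

section MatrixLemmas

open Matrix

variable {ι : Type*} [Fintype ι]

/-- A real symmetric matrix with nonpositive entries has a nonzero entrywise nonnegative
eigenvector. -/
theorem exists_nonneg_eigenvector [Nonempty ι] (H : Matrix ι ι ℝ)
    (hsymm : ∀ i j, H i j = H j i) (hnonpos : ∀ i j, H i j ≤ 0) :
    ∃ (E : ℝ) (v : ι → ℝ), v ≠ 0 ∧ (∀ i, 0 ≤ v i) ∧ H *ᵥ v = E • v := by
  classical
  have hH : H.IsHermitian := by
    ext i j
    simp [hsymm i j]
  obtain ⟨k, hk⟩ := Finite.exists_min hH.eigenvalues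
  set E := hH.eigenvalues k with hE
  set u : ι → ℝ := WithLp.ofLp (hH.eigenvectorBasis k) with hu
  have hHu : H *ᵥ u = E • u := hH.mulVec_eigenvectorBasis k
  have hu0 : u ≠ 0 := by
    intro h
    apply hH.eigenvectorBasis.orthonormal.ne_zero k
    ext i
    exact congrFun h i
  have hpsd : (H - E • (1 : Matrix ι ι ℝ)).PosSemidef := by
    have hherm : (H - E • (1 : Matrix ι ι ℝ)).IsHermitian := by
      ext i j
      simp [hsymm i j, Matrix.one_apply, eq_comm]
    refine hherm.posSemidef_iff_eigenvalues_nonneg.mpr fun i => ?_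
    have hmv := hherm.mulVec_eigenvectorBasis i
    set w : ι → ℝ := WithLp.ofLp (hherm.eigenvectorBasis i) with hw
    have hw0 : w ≠ 0 := by
      intro h
      apply hherm.eigenvectorBasis.orthonormal.ne_zero i
      ext i
      exact congrFun h i
    have hHw : H *ᵥ w = (hherm.eigenvalues i + E) • w := by
      rw [sub_mulVec, smul_mulVec, one_mulVec, sub_eq_iff_eq_add] at hmv
      rw [hmv, add_smul]
    have hmem : hherm.eigenvalues i + E ∈ spectrum ℝ H := by
      rw [← Matrix.spectrum_toLin']
      refine Module.End.HasEigenvalue.mem_spectrum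
        (Module.End.hasEigenvalue_of_hasEigenvector (x := w) ⟨?_, hw0⟩)
      rw [Module.End.mem_eigenspace_iff, Matrix.toLin'_apply, hHw]
    rw [hH.spectrum_real_eq_range_eigenvalues] at hmem
    obtain ⟨j, hj⟩ := hmem
    have := hk j
    simp only [Pi.zero_apply]
    linarith
  refine ⟨E, fun i => |u i|, ?_, fun i => abs_nonneg _, ?_⟩
  · intro h
    exact hu0 (funext fun i => by simpa using congrFun h i)
  · have hform : ∀ v : ι → ℝ, v ⬝ᵥ ((H - E • (1 : Matrix ι ι ℝ)) *ᵥ v) =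
        ∑ i, ∑ j, H i j * (v i * v j) - E * ∑ i, v i ^ 2 := by
      intro v
      rw [sub_mulVec, smul_mulVec, one_mulVec, dotProduct_sub, dotProduct_smul]
      simp only [dotProduct, mulVec, Finset.mul_sum, smul_eq_mul, pow_two]
      congr 1
      exact Finset.sum_congr rfl fun i _ => Finset.sum_congr rfl fun j _ => by ring
    have hzero : u ⬝ᵥ ((H - E • (1 : Matrix ι ι ℝ)) *ᵥ u) = 0 := by
      rw [sub_mulVec, smul_mulVec, one_mulVec, hHu, sub_self, dotProduct_zero]
    have hle : (fun i => |u i|) ⬝ᵥ ((H - E • (1 : Matrix ι ι ℝ)) *ᵥ fun i => |u i|) ≤ 0 := by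
      rw [← hzero, hform, hform]
      simp only [sq_abs]
      refine sub_le_sub_right (Finset.sum_le_sum fun i _ => Finset.sum_le_sum fun j _ => ?_) _
      refine mul_le_mul_of_nonpos_left ?_ (hnonpos i j)
      rw [← abs_mul]
      exact le_abs_self _
    have hge := hpsd.dotProduct_mulVec_nonneg (fun i => |u i|)
    rw [star_trivial] at hge
    have hker := (hpsd.dotProduct_mulVec_zero_iff (fun i => |u i|)).mp
      (by rw [star_trivial]; exact le_antisymm hle hge)
    rw [sub_mulVec, smul_mulVec, one_mulVec, sub_eq_zero] at hker
    exact hker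

/-- Ground-state representation of the quadratic form of `H - E` relative to a positive
eigenvector `ψ` with eigenvalue `E`. -/
theorem sum_mul_sq_sub_div (H : Matrix ι ι ℝ) (hsymm : ∀ i j, H i j = H j i) {E μ : ℝ}
    {ψ Φ : ι → ℝ} (hψ : ∀ i, 0 < ψ i) (hE : H *ᵥ ψ = E • ψ) (hΦ : H *ᵥ Φ = μ • Φ) :
    ∑ i, ∑ j, H i j * (ψ i * ψ j * (Φ i / ψ i - Φ j / ψ j) ^ 2) =
      2 * (E - μ) * ∑ i, Φ i ^ 2 := by
  have h1 : ∑ i, ∑ j, H i j * (ψ j * (Φ i ^ 2 / ψ i)) = E * ∑ i, Φ i ^ 2 := by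
    rw [Finset.mul_sum]
    refine Finset.sum_congr rfl fun i _ => ?_
    have := congrFun hE i
    simp only [mulVec, dotProduct, Pi.smul_apply, smul_eq_mul] at this
    simp only [← mul_assoc]
    rw [← Finset.sum_mul, this]
    have := (hψ i).ne'
    field_simp
  have h2 : ∑ i, ∑ j, H i j * (ψ i * (Φ j ^ 2 / ψ j)) = E * ∑ i, Φ i ^ 2 := by
    rw [Finset.sum_comm, ← h1]
    exact Finset.sum_congr rfl fun i _ => Finset.sum_congr rfl fun j _ => by rw [hsymm]
  have h3 : ∑ i, ∑ j, H i j * (Φ i * Φ j) = μ * ∑ i, Φ i ^ 2 := by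
    rw [Finset.mul_sum]
    refine Finset.sum_congr rfl fun i _ => ?_
    have := congrFun hΦ i
    simp only [mulVec, dotProduct, Pi.smul_apply, smul_eq_mul] at this
    rw [pow_two, ← mul_assoc, ← this, Finset.sum_mul]
    exact Finset.sum_congr rfl fun j _ => by ring
  have h4 : ∀ i j, H i j * (ψ i * ψ j * (Φ i / ψ i - Φ j / ψ j) ^ 2) =
      H i j * (ψ j * (Φ i ^ 2 / ψ i)) + H i j * (ψ i * (Φ j ^ 2 / ψ j)) -
        2 * (H i j * (Φ i * Φ j)) := by
    intro i j
    have hi := (hψ i).ne'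
    have hj := (hψ j).ne'
    field_simp
    ring
  simp only [h4, Finset.sum_sub_distrib, Finset.sum_add_distrib, ← Finset.mul_sum, h1, h2, h3]
  ring

/-- The eigenvalue of a positive eigenvector is the lowest one. -/
theorem le_of_pos_eigenvector (H : Matrix ι ι ℝ) (hsymm : ∀ i j, H i j = H j i)
    (hnonpos : ∀ i j, H i j ≤ 0) {E μ : ℝ} {ψ Φ : ι → ℝ} (hψ : ∀ i, 0 < ψ i)
    (hE : H *ᵥ ψ = E • ψ) (hΦ : H *ᵥ Φ = μ • Φ) (hΦ0 : Φ ≠ 0) : E ≤ μ := by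
  have hsum := sum_mul_sq_sub_div H hsymm hψ hE hΦ
  have hle : ∑ i, ∑ j, H i j * (ψ i * ψ j * (Φ i / ψ i - Φ j / ψ j) ^ 2) ≤ 0 :=
    Finset.sum_nonpos fun i _ => Finset.sum_nonpos fun j _ =>
      mul_nonpos_of_nonpos_of_nonneg (hnonpos i j)
        (mul_nonneg (mul_pos (hψ i) (hψ j)).le (sq_nonneg _))
  obtain ⟨k, hk⟩ := Function.ne_iff.mp hΦ0
  have hpos : 0 < ∑ i, Φ i ^ 2 :=
    Finset.sum_pos' (fun i _ => sq_nonneg _) ⟨k, Finset.mem_univ k, by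
      have : Φ k ≠ 0 := hk
      positivity⟩
  by_contra! h
  have : 0 < 2 * (E - μ) * ∑ i, Φ i ^ 2 := mul_pos (by linarith) hpos
  linarith

/-- An eigenvector for the lowest eigenvalue is a locally constant multiple of the positive
eigenvector. -/
theorem div_eq_div_of_eigenvector (H : Matrix ι ι ℝ) (hsymm : ∀ i j, H i j = H j i)
    (hnonpos : ∀ i j, H i j ≤ 0) {E : ℝ} {ψ Φ : ι → ℝ} (hψ : ∀ i, 0 < ψ i)
    (hE : H *ᵥ ψ = E • ψ) (hΦ : H *ᵥ Φ = E • Φ) {i j : ι} (hij : H i j ≠ 0) :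
    Φ i / ψ i = Φ j / ψ j := by
  have hsum := sum_mul_sq_sub_div H hsymm hψ hE hΦ
  rw [sub_self, mul_zero, zero_mul] at hsum
  have hterm : ∀ i j, H i j * (ψ i * ψ j * (Φ i / ψ i - Φ j / ψ j) ^ 2) ≤ 0 := fun i j =>
    mul_nonpos_of_nonpos_of_nonneg (hnonpos i j)
      (mul_nonneg (mul_pos (hψ i) (hψ j)).le (sq_nonneg _))
  have h1 := (Finset.sum_eq_zero_iff_of_nonpos
    fun i _ => Finset.sum_nonpos fun j _ => hterm i j).mp hsum i (Finset.mem_univ i)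
  have h2 := (Finset.sum_eq_zero_iff_of_nonpos fun j _ => hterm i j).mp h1 j (Finset.mem_univ j)
  have hp := (mul_pos (hψ i) (hψ j)).ne'
  have h3 : (Φ i / ψ i - Φ j / ψ j) ^ 2 = 0 := by
    rcases mul_eq_zero.mp h2 with h | h
    · exact absurd h hij
    · exact (mul_eq_zero.mp h).resolve_left hp
  exact sub_eq_zero.mp (pow_eq_zero_iff (two_ne_zero) |>.mp h3)

/-- The zero set of a nonnegative eigenvector is closed under passing to neighbours. -/
theorem eq_zero_of_nonneg_eigenvector (H : Matrix ι ι ℝ)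
    (hnonpos : ∀ i j, H i j ≤ 0) {E : ℝ} {ψ : ι → ℝ} (hψ : ∀ i, 0 ≤ ψ i)
    (hE : H *ᵥ ψ = E • ψ) {i j : ι} (hij : H i j ≠ 0) (hi : ψ i = 0) : ψ j = 0 := by
  have h := congrFun hE i
  simp only [mulVec, dotProduct, Pi.smul_apply, smul_eq_mul, hi, mul_zero] at h
  have h2 := (Finset.sum_eq_zero_iff_of_nonpos fun j _ =>
    mul_nonpos_of_nonpos_of_nonneg (hnonpos i j) (hψ j)).mp h j (Finset.mem_univ j)
  exact (mul_eq_zero.mp h2).resolve_left hij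

end MatrixLemmas

section Hops

variable {Ns : ℕ}

theorem update_update_eq_comp_swap (ω : ChainCfg Ns) {a b : ZMod Ns} (hb : ω b = none) :
    Function.update (Function.update ω a none) b (ω a) = ω ∘ Equiv.swap a b := by
  funext z
  simp only [Function.comp_apply, Equiv.swap_apply_def, Function.update_apply]
  split_ifs <;> simp_all

theorem nnHop_iff (ω ω' : ChainCfg Ns) :
    NNHop ω ω' ↔ ∃ x : ZMod Ns, (ω x = none ↔ ω (x + 1) ≠ none) ∧
      ω' = ω ∘ Equiv.swap x (x + 1) := by
  refine exists_congr fun x => ⟨?_, ?_⟩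
  · rintro (⟨h1, h2, h3⟩ | ⟨h1, h2, h3⟩)
    · exact ⟨by tauto, by rw [h3, update_update_eq_comp_swap ω h2]⟩
    · exact ⟨by tauto, by rw [h3, update_update_eq_comp_swap ω h2, Equiv.swap_comm]⟩
  · rintro ⟨h1, h2⟩
    by_cases h : ω x = none
    · exact Or.inr ⟨h1.mp h, h, by
        rw [h2, update_update_eq_comp_swap ω h, Equiv.swap_comm]⟩
    · have h' : ω (x + 1) = none := by tauto
      exact Or.inl ⟨h, h', by rw [h2, update_update_eq_comp_swap ω h']⟩

theorem evenNNNHop_iff [NeZero Ns] (ω ω' : ChainCfg Ns) :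
    EvenNNNHop ω ω' ↔ ∃ x : ZMod Ns, x.val % 2 = 0 ∧ (ω x = none ↔ ω (x + 2) ≠ none) ∧
      ω' = ω ∘ Equiv.swap x (x + 2) := by
  refine exists_congr fun x => and_congr_right fun _ => ⟨?_, ?_⟩
  · rintro (⟨h1, h2, h3⟩ | ⟨h1, h2, h3⟩)
    · exact ⟨by tauto, by rw [h3, update_update_eq_comp_swap ω h2]⟩
    · exact ⟨by tauto, by rw [h3, update_update_eq_comp_swap ω h2, Equiv.swap_comm]⟩
  · rintro ⟨h1, h2⟩
    by_cases h : ω x = none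
    · exact Or.inr ⟨h1.mp h, h, by
        rw [h2, update_update_eq_comp_swap ω h, Equiv.swap_comm]⟩
    · have h' : ω (x + 2) = none := by tauto
      exact Or.inl ⟨h, h', by rw [h2, update_update_eq_comp_swap ω h']⟩

theorem comp_swap_comp_swap {α β : Type*} [DecidableEq α] (f : α → β) (a b : α) :
    (f ∘ Equiv.swap a b) ∘ Equiv.swap a b = f := by
  funext z
  simp

theorem NNHop.symm {ω ω' : ChainCfg Ns} (h : NNHop ω ω') : NNHop ω' ω := by
  rw [nnHop_iff] at h ⊢
  obtain ⟨x, hx, rfl⟩ := h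
  refine ⟨x, ?_, (comp_swap_comp_swap ω _ _).symm⟩
  simp only [Function.comp_apply, Equiv.swap_apply_left, Equiv.swap_apply_right]
  tauto

theorem EvenNNNHop.symm [NeZero Ns] {ω ω' : ChainCfg Ns} (h : EvenNNNHop ω ω') :
    EvenNNNHop ω' ω := by
  rw [evenNNNHop_iff] at h ⊢
  obtain ⟨x, hx0, hx, rfl⟩ := h
  refine ⟨x, hx0, ?_, (comp_swap_comp_swap ω _ _).symm⟩
  simp only [Function.comp_apply, Equiv.swap_apply_left, Equiv.swap_apply_right]
  tauto

/-- A hop of either kind allowed by the Hamiltonian. -/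
def Hop [NeZero Ns] (ω ω' : ChainCfg Ns) : Prop :=
  NNHop ω ω' ∨ EvenNNNHop ω ω'

theorem Hop.exists_swap [NeZero Ns] {ω ω' : ChainCfg Ns} (h : Hop ω ω') :
    ∃ x y : ZMod Ns, (ω x = none ↔ ω y ≠ none) ∧ ω' = ω ∘ Equiv.swap x y := by
  rcases h with h | h
  · obtain ⟨x, h⟩ := (nnHop_iff _ _).mp h
    exact ⟨x, x + 1, h⟩
  · obtain ⟨x, -, h⟩ := (evenNNNHop_iff _ _).mp h
    exact ⟨x, x + 2, h⟩

theorem Hop.symm [NeZero Ns] {ω ω' : ChainCfg Ns} (h : Hop ω ω') : Hop ω' ω :=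
  h.imp NNHop.symm EvenNNNHop.symm

theorem card_filter_comp_perm {α : Type*} [Fintype α] {β : Type*} (p : β → Prop)
    [DecidablePred p] (f : α → β) (σ : Equiv.Perm α) :
    (Finset.univ.filter fun x => p ((f ∘ σ) x)).card =
      (Finset.univ.filter fun x => p (f x)).card :=
  Finset.card_equiv σ (by simp)

theorem occNum_comp_perm [NeZero Ns] (ω : ChainCfg Ns) (σ : Equiv.Perm (ZMod Ns)) :
    occNum (ω ∘ σ) = occNum ω :=
  card_filter_comp_perm (fun v => v ≠ none) ω σ

theorem upNum_comp_perm [NeZero Ns] (ω : ChainCfg Ns) (σ : Equiv.Perm (ZMod Ns)) :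
    upNum (ω ∘ σ) = upNum ω :=
  card_filter_comp_perm (fun v => v = some true) ω σ

theorem Hop.occNum_eq [NeZero Ns] {ω ω' : ChainCfg Ns} (h : Hop ω ω') :
    occNum ω' = occNum ω := by
  obtain ⟨x, y, -, rfl⟩ := h.exists_swap
  exact occNum_comp_perm ω _

theorem Hop.upNum_eq [NeZero Ns] {ω ω' : ChainCfg Ns} (h : Hop ω ω') :
    upNum ω' = upNum ω := by
  obtain ⟨x, y, -, rfl⟩ := h.exists_swap
  exact upNum_comp_perm ω _

theorem upNum_le_occNum [NeZero Ns] (ω : ChainCfg Ns) : upNum ω ≤ occNum ω :=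
  Finset.card_le_card fun x => by
    simp only [Finset.mem_filter, Finset.mem_univ, true_and]
    intro h
    simp [h]

/-- No two cyclically adjacent sites are empty. -/
def NoAdjHoles (ω : ChainCfg Ns) : Prop :=
  ∀ x : ZMod Ns, ¬(ω x = none ∧ ω (x + 1) = none)

/-- Two configurations are connected when they are joined by a chain of hops through
configurations without adjacent empty sites. -/
def Conn [NeZero Ns] : ChainCfg Ns → ChainCfg Ns → Prop :=
  Relation.EqvGen fun ω ω' => NoAdjHoles ω ∧ NoAdjHoles ω' ∧ Hop ω ω'

theorem Conn.refl [NeZero Ns] (ω : ChainCfg Ns) : Conn ω ω :=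
  Relation.EqvGen.refl _

theorem Conn.symm [NeZero Ns] {ω ω' : ChainCfg Ns} (h : Conn ω ω') : Conn ω' ω :=
  Relation.EqvGen.symm _ _ h

theorem Conn.trans [NeZero Ns] {ω₁ ω₂ ω₃ : ChainCfg Ns} (h : Conn ω₁ ω₂) (h' : Conn ω₂ ω₃) :
    Conn ω₁ ω₃ :=
  Relation.EqvGen.trans _ _ _ h h'

theorem Hop.conn [NeZero Ns] {ω ω' : ChainCfg Ns} (h : Hop ω ω') (h1 : NoAdjHoles ω)
    (h2 : NoAdjHoles ω') : Conn ω ω' :=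
  Relation.EqvGen.rel _ _ ⟨h1, h2, h⟩

theorem Conn.occNum_eq [NeZero Ns] {ω ω' : ChainCfg Ns} (h : Conn ω ω') :
    occNum ω = occNum ω' := by
  induction h with
  | rel _ _ h => exact h.2.2.occNum_eq.symm
  | refl _ => rfl
  | symm _ _ _ ih => exact ih.symm
  | trans _ _ _ _ _ ih1 ih2 => exact ih1.trans ih2

theorem Conn.upNum_eq [NeZero Ns] {ω ω' : ChainCfg Ns} (h : Conn ω ω') :
    upNum ω = upNum ω' := by
  induction h with
  | rel _ _ h => exact h.2.2.upNum_eq.symm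
  | refl _ => rfl
  | symm _ _ _ ih => exact ih.symm
  | trans _ _ _ _ _ ih1 ih2 => exact ih1.trans ih2

/-- A function of allowed configurations that is constant along hops is constant along
connected configurations. -/
theorem Conn.apply_eq [NeZero Ns] {Ne : ℕ} {α : Type*} (F : AllowedCfg Ns Ne → α)
    (hF : ∀ a b : AllowedCfg Ns Ne, Hop a.1 b.1 → F a = F b) {a b : AllowedCfg Ns Ne}
    (h : Conn a.1 b.1) : F a = F b := by
  classical
  let G : ChainCfg Ns → Option α := fun ω =>
    if hω : occNum ω = Ne ∧ NoAdjHoles ω then some (F ⟨ω, hω⟩) else none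
  have key : ∀ ω ω' : ChainCfg Ns, Conn ω ω' → G ω = G ω' := by
    intro ω ω' h
    induction h with
    | rel x y h =>
      obtain ⟨hx, hy, hxy⟩ := h
      by_cases hocc : occNum x = Ne
      · have hocc' : occNum y = Ne := hxy.occNum_eq.trans hocc
        simp only [G, dif_pos (And.intro hocc hx), dif_pos (And.intro hocc' hy)]
        exact congrArg some (hF _ _ hxy)
      · have hocc' : occNum y ≠ Ne := fun h => hocc (hxy.occNum_eq.symm.trans h)
        simp only [G, hocc, hocc', false_and, dif_neg, not_false_eq_true]
    | refl _ => rfl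
    | symm _ _ _ ih => exact ih.symm
    | trans _ _ _ _ _ ih1 ih2 => exact ih1.trans ih2
  have := key _ _ h
  simp only [G] at this
  rw [dif_pos (show occNum a.1 = Ne ∧ NoAdjHoles a.1 from a.2),
    dif_pos (show occNum b.1 = Ne ∧ NoAdjHoles b.1 from b.2)] at this
  exact Option.some.inj this

end Hops

section Connectivity

variable {Ns : ℕ} [NeZero Ns]

/-- Sites whose representative in `{0, …, Ns - 1}` is even. -/
def EvenSite (x : ZMod Ns) : Prop :=
  x.val % 2 = 0

theorem evenSite_add (hNs : Even Ns) (x y : ZMod Ns) :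
    EvenSite (x + y) ↔ (EvenSite x ↔ EvenSite y) := by
  obtain ⟨m, hm⟩ := hNs
  simp only [EvenSite, ZMod.val_add]
  rw [Nat.mod_mod_of_dvd _ (by omega : 2 ∣ Ns)]
  omega

theorem not_evenSite_one (hNs : Even Ns) : ¬EvenSite (1 : ZMod Ns) := by
  obtain ⟨m, hm⟩ := hNs
  have : Ns ≠ 0 := NeZero.ne Ns
  have : Fact (1 < Ns) := ⟨by omega⟩
  simp [EvenSite, ZMod.val_one]

theorem evenSite_add_one (hNs : Even Ns) (x : ZMod Ns) : EvenSite (x + 1) ↔ ¬EvenSite x := by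
  rw [evenSite_add hNs]
  have := not_evenSite_one hNs
  tauto

theorem evenSite_sub_one (hNs : Even Ns) (x : ZMod Ns) : EvenSite (x - 1) ↔ ¬EvenSite x := by
  have := evenSite_add_one hNs (x - 1)
  rw [sub_add_cancel] at this
  tauto

theorem evenSite_add_sign (hNs : Even Ns) {s : ZMod Ns} (hs : s = 1 ∨ s = -1) (x : ZMod Ns) :
    EvenSite (x + s) ↔ ¬EvenSite x := by
  rcases hs with rfl | rfl
  · exact evenSite_add_one hNs x
  · rw [← sub_eq_add_neg]
    exact evenSite_sub_one hNs x

theorem evenSite_two_mul (hNs : Even Ns) (x : ZMod Ns) : EvenSite (2 * x) := by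
  rw [two_mul, evenSite_add hNs]

theorem evenSite_add_two_mul (hNs : Even Ns) (x y : ZMod Ns) :
    EvenSite (x + 2 * y) ↔ EvenSite x := by
  rw [evenSite_add hNs]
  have := evenSite_two_mul hNs y
  tauto

theorem exists_eq_add_two_mul (hNs : Even Ns) {x y : ZMod Ns}
    (h : EvenSite x ↔ EvenSite y) : ∃ k : ℕ, y = x + 2 * k := by
  have hd : EvenSite (y - x) := by
    have := evenSite_add hNs (y - x) x
    rw [sub_add_cancel] at this
    tauto
  refine ⟨(y - x).val / 2, ?_⟩
  have h2 : 2 * ((y - x).val / 2) = (y - x).val := by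
    have : (y - x).val % 2 = 0 := hd
    omega
  have h3 : ((2 * ((y - x).val / 2) : ℕ) : ZMod Ns) = y - x := by
    rw [h2, ZMod.natCast_zmod_val]
  push_cast at h3
  rw [h3]
  ring

/-- The set of empty sites. -/
def holes (ω : ChainCfg Ns) : Set (ZMod Ns) :=
  {x | ω x = none}

/-- All sites of `P` are even. -/
def EvenHoles (P : Set (ZMod Ns)) : Prop :=
  ∀ x ∈ P, EvenSite x

omit [NeZero Ns] in
theorem noAdjHoles_iff {s : ZMod Ns} (hs : s = 1 ∨ s = -1) (ω : ChainCfg Ns) :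
    NoAdjHoles ω ↔ ∀ x, ¬(x ∈ holes ω ∧ x + s ∈ holes ω) := by
  rcases hs with rfl | rfl
  · rfl
  · refine ⟨fun h x hx => h (x + -1) ⟨hx.2, ?_⟩, fun h x hx => h (x + 1) ⟨hx.2, ?_⟩⟩
    · rw [neg_add_cancel_right]
      exact hx.1
    · rw [add_neg_cancel_right]
      exact hx.1

theorem EvenHoles.noAdjHoles (hNs : Even Ns) {ω : ChainCfg Ns} (h : EvenHoles (holes ω)) :
    NoAdjHoles ω :=
  fun x hx => (evenSite_add_one hNs x).mp (h _ hx.2) (h _ hx.1)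

omit [NeZero Ns] in
theorem EvenHoles.preimage_swap {P : Set (ZMod Ns)} (h : EvenHoles P) {a b : ZMod Ns}
    (ha : EvenSite a) (hb : EvenSite b) : EvenHoles (Equiv.swap a b ⁻¹' P) := by
  intro x hx
  by_cases hxa : x = a
  · exact hxa ▸ ha
  by_cases hxb : x = b
  · exact hxb ▸ hb
  rw [Set.mem_preimage, Equiv.swap_apply_of_ne_of_ne hxa hxb] at hx
  exact h x hx

omit [NeZero Ns] in
theorem holes_comp_swap_of_notMem {ω : ChainCfg Ns} {a b : ZMod Ns} (ha : a ∉ holes ω)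
    (hb : b ∉ holes ω) : holes (ω ∘ Equiv.swap a b) = holes ω := by
  ext x
  change Equiv.swap a b x ∈ holes ω ↔ x ∈ holes ω
  rw [Equiv.swap_apply_def]
  split_ifs with h1 h2
  · subst h1; tauto
  · subst h2; tauto
  · rfl

omit [NeZero Ns] in
theorem comp_swap_of_mem_of_mem {ω : ChainCfg Ns} {a b : ZMod Ns} (ha : a ∈ holes ω)
    (hb : b ∈ holes ω) : ω ∘ Equiv.swap a b = ω := by
  funext x
  have ha' : ω a = none := ha
  have hb' : ω b = none := hb
  simp only [Function.comp_apply, Equiv.swap_apply_def]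
  split_ifs with h1 h2
  · rw [h1, ha', hb']
  · rw [h2, ha', hb']
  · rfl

theorem conn_swap_nn {s : ZMod Ns} (hs : s = 1 ∨ s = -1) {ω : ChainCfg Ns} {x : ZMod Ns}
    (h1 : NoAdjHoles ω) (h2 : NoAdjHoles (ω ∘ Equiv.swap x (x + s)))
    (hx : ω x = none ↔ ω (x + s) ≠ none) : Conn ω (ω ∘ Equiv.swap x (x + s)) := by
  refine Hop.conn (Or.inl ((nnHop_iff _ _).mpr ?_)) h1 h2
  rcases hs with rfl | rfl
  · exact ⟨x, hx, rfl⟩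
  · refine ⟨x + -1, ?_, ?_⟩
    · rw [neg_add_cancel_right]
      tauto
    · rw [neg_add_cancel_right, Equiv.swap_comm]

theorem conn_swap_nnn (hNs : Even Ns) {s : ZMod Ns} (hs : s = 1 ∨ s = -1) {ω : ChainCfg Ns}
    {x : ZMod Ns} (hω : EvenHoles (holes ω)) (hx : EvenSite x)
    (hh : x ∈ holes ω ∨ x + 2 * s ∈ holes ω) : Conn ω (ω ∘ Equiv.swap x (x + 2 * s)) := by
  have hx2 : EvenSite (x + 2 * s) := (evenSite_add_two_mul hNs x s).mpr hx
  by_cases hb : x ∈ holes ω ∧ x + 2 * s ∈ holes ω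
  · rw [comp_swap_of_mem_of_mem hb.1 hb.2]
    exact Conn.refl ω
  have hxor : ω x = none ↔ ω (x + 2 * s) ≠ none := by
    simp only [holes, Set.mem_ofPred_eq] at hb hh
    tauto
  refine Hop.conn (Or.inr ((evenNNNHop_iff _ _).mpr ?_)) (hω.noAdjHoles hNs)
    ((hω.preimage_swap hx hx2).noAdjHoles (ω := ω ∘ Equiv.swap x (x + 2 * s)) hNs)
  rcases hs with rfl | rfl
  · rw [mul_one] at hxor ⊢
    exact ⟨x, hx, hxor, rfl⟩
  · refine ⟨x + 2 * -1, hx2, ?_, ?_⟩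
    · rw [show x + 2 * -1 + 2 = x by ring]
      tauto
    · rw [show x + 2 * -1 + 2 = x by ring, Equiv.swap_comm]

/-- Exchanging the spins at the occupied sites `a` and `b` of any configuration with hole
set `P` can be achieved by hops. -/
def Exch (P : Set (ZMod Ns)) (a b : ZMod Ns) : Prop :=
  a ∉ P ∧ b ∉ P ∧ ∀ ω, holes ω = P → Conn ω (ω ∘ Equiv.swap a b)

theorem Exch.refl {P : Set (ZMod Ns)} {a : ZMod Ns} (ha : a ∉ P) : Exch P a a :=
  ⟨ha, ha, fun ω _ => by
    rw [Equiv.swap_self]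
    exact Conn.refl ω⟩

theorem Exch.symm {P : Set (ZMod Ns)} {a b : ZMod Ns} (h : Exch P a b) : Exch P b a :=
  ⟨h.2.1, h.1, fun ω hω => by
    rw [Equiv.swap_comm]
    exact h.2.2 ω hω⟩

theorem Exch.trans {P : Set (ZMod Ns)} {a b c : ZMod Ns} (hab : Exch P a b)
    (hbc : Exch P b c) : Exch P a c := by
  by_cases hac : a = c
  · subst hac
    exact Exch.refl hab.1
  by_cases hb : a = b
  · subst hb
    exact hbc
  refine ⟨hab.1, hbc.2.1, fun ω hω => ?_⟩
  have h1 := hbc.2.2 ω hω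
  have hω1 : holes (ω ∘ Equiv.swap b c) = P := by
    rw [holes_comp_swap_of_notMem (hω ▸ hbc.1) (hω ▸ hbc.2.1), hω]
  have h2 := hab.2.2 _ hω1
  have hω2 : holes ((ω ∘ Equiv.swap b c) ∘ Equiv.swap a b) = P := by
    rw [holes_comp_swap_of_notMem (hω1 ▸ hab.1) (hω1 ▸ hab.2.1), hω1]
  have h3 := hbc.2.2 _ hω2
  have hcomp : ((ω ∘ Equiv.swap b c) ∘ Equiv.swap a b) ∘ Equiv.swap b c =
      ω ∘ Equiv.swap a c := by
    rw [Equiv.swap_comm a c, ← Equiv.swap_mul_swap_mul_swap hb hac]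
    rfl
  rw [hcomp] at h3
  exact (h1.trans h2).trans h3

/-- Exchanges are transported along hops of holes between even sites. -/
theorem Exch.transport (hNs : Even Ns) {s : ZMod Ns} (hs : s = 1 ∨ s = -1)
    {P : Set (ZMod Ns)} (hP : EvenHoles P) {x a b : ZMod Ns} (hx : EvenSite x)
    (hh : x ∈ P ∨ x + 2 * s ∈ P) (h : Exch (Equiv.swap x (x + 2 * s) ⁻¹' P) a b) :
    Exch P (Equiv.swap x (x + 2 * s) a) (Equiv.swap x (x + 2 * s) b) := by
  set σ := Equiv.swap x (x + 2 * s) with hσ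
  refine ⟨h.1, h.2.1, fun ω hω => ?_⟩
  subst hω
  have h1 : Conn ω (ω ∘ σ) := conn_swap_nnn hNs hs hP hx hh
  have h2 := h.2.2 (ω ∘ σ) rfl
  have h3holes : holes (ω ∘ Equiv.swap (σ a) (σ b)) = holes ω :=
    holes_comp_swap_of_notMem h.1 h.2.1
  have h3 : Conn (ω ∘ Equiv.swap (σ a) (σ b)) ((ω ∘ Equiv.swap (σ a) (σ b)) ∘ σ) :=
    conn_swap_nnn hNs hs (h3holes ▸ hP) hx (h3holes ▸ hh)
  have hcomp : (ω ∘ Equiv.swap (σ a) (σ b)) ∘ σ = (ω ∘ σ) ∘ Equiv.swap a b := by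
    rw [Equiv.swap_apply_apply]
    funext z
    simp
  rw [hcomp] at h3
  exact (h1.trans h2).trans h3.symm

/-- A hole hopping around a triangle exchanges the two spins next to it. -/
theorem exch_of_hole (hNs : Even Ns) {s : ZMod Ns} (hs : s = 1 ∨ s = -1)
    {P : Set (ZMod Ns)} (hP : EvenHoles P) {h : ZMod Ns} (hh : h ∈ P) (hh2 : h + 2 * s ∉ P) :
    Exch P (h + s) (h + 2 * s) := by
  have heven : EvenSite h := hP h hh
  have hodd : ¬EvenSite (h + s) := by rw [evenSite_add_sign hNs hs]; tauto
  have heven2 : EvenSite (h + 2 * s) := (evenSite_add_two_mul hNs h s).mpr heven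
  have hsP : h + s ∉ P := fun hc => hodd (hP _ hc)
  have hne1 : h ≠ h + s := fun hc => hodd (hc ▸ heven)
  have hne2 : h + 2 * s ≠ h + s := fun hc => hodd (hc ▸ heven2)
  have hne3 : h ≠ h + 2 * s := fun hc => hh2 (hc ▸ hh)
  refine ⟨hsP, hh2, fun ω hω => ?_⟩
  subst hω
  have hs2 : h + s + s = h + 2 * s := by ring
  set τ := ω ∘ Equiv.swap (h + s) (h + 2 * s) with hτ
  have hτholes : holes τ = holes ω := holes_comp_swap_of_notMem hsP hh2
  have hcomp : (ω ∘ Equiv.swap h (h + s)) ∘ Equiv.swap (h + s) (h + s + s) =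
      τ ∘ Equiv.swap h (h + 2 * s) := by
    rw [hτ, hs2]
    funext z
    simp only [Function.comp_apply]
    congr 1
    by_cases hz1 : z = h
    · subst hz1
      rw [Equiv.swap_apply_of_ne_of_ne hne1 hne3, Equiv.swap_apply_left,
        Equiv.swap_apply_left, Equiv.swap_apply_right]
    by_cases hz2 : z = h + s
    · rw [hz2, Equiv.swap_apply_left, Equiv.swap_apply_of_ne_of_ne hne3.symm hne2,
        Equiv.swap_apply_of_ne_of_ne hne1.symm hne2.symm, Equiv.swap_apply_left]
    by_cases hz3 : z = h + 2 * s
    · rw [hz3, Equiv.swap_apply_right, Equiv.swap_apply_right, Equiv.swap_apply_right,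
        Equiv.swap_apply_of_ne_of_ne hne1 hne3]
    rw [Equiv.swap_apply_of_ne_of_ne hz2 hz3, Equiv.swap_apply_of_ne_of_ne hz1 hz2,
      Equiv.swap_apply_of_ne_of_ne hz1 hz3, Equiv.swap_apply_of_ne_of_ne hz2 hz3]
  have hτEven : EvenHoles (holes τ) := hτholes ▸ hP
  have hτconn : Conn τ (τ ∘ Equiv.swap h (h + 2 * s)) :=
    conn_swap_nnn hNs hs hτEven heven (Or.inl (hτholes ▸ hh))
  have hτadj : NoAdjHoles (τ ∘ Equiv.swap h (h + 2 * s)) :=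
    EvenHoles.noAdjHoles hNs (hτEven.preimage_swap heven heven2)
  have h1adj : NoAdjHoles (ω ∘ Equiv.swap h (h + s)) := by
    have hmem : ∀ w, w ∈ holes (ω ∘ Equiv.swap h (h + s)) →
        w = h + s ∨ (w ∈ holes ω ∧ w ≠ h) := by
      intro w hw
      change Equiv.swap h (h + s) w ∈ holes ω at hw
      by_cases hw1 : w = h + s
      · exact Or.inl hw1
      by_cases hw2 : w = h
      · rw [hw2, Equiv.swap_apply_left] at hw
        exact absurd hw hsP
      · rw [Equiv.swap_apply_of_ne_of_ne hw2 hw1] at hw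
        exact Or.inr ⟨hw, hw2⟩
    rw [noAdjHoles_iff hs]
    rintro z ⟨hz, hzs⟩
    rcases hmem z hz with rfl | ⟨hz1, hz2⟩ <;> rcases hmem _ hzs with h' | ⟨h1', h2'⟩
    · exact hne2 (hs2 ▸ h')
    · exact hh2 (hs2 ▸ h1')
    · exact hz2 (add_right_cancel h')
    · exact (evenSite_add_sign hNs hs z).mp (hP _ h1') (hP _ hz1)
  have h1 : Conn ω (ω ∘ Equiv.swap h (h + s)) := by
    refine conn_swap_nn hs (hP.noAdjHoles hNs) h1adj ⟨fun _ => hsP, fun _ => hh⟩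
  have h2 : Conn (ω ∘ Equiv.swap h (h + s))
      ((ω ∘ Equiv.swap h (h + s)) ∘ Equiv.swap (h + s) (h + s + s)) := by
    refine conn_swap_nn hs h1adj (hcomp ▸ hτadj) ⟨fun _ => ?_, fun _ => ?_⟩
    · rw [hs2, Function.comp_apply, Equiv.swap_apply_of_ne_of_ne hne3.symm hne2]
      exact hh2
    · rw [Function.comp_apply, Equiv.swap_apply_right]
      exact hh
  rw [hcomp] at h2
  exact (h1.trans h2).trans hτconn.symm

theorem exch_even_odd_of_hole_at (hNs : Even Ns) {s : ZMod Ns} (hs : s = 1 ∨ s = -1)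
    {y : ZMod Ns} (hy : EvenSite y) (k : ℕ) :
    ∀ P : Set (ZMod Ns), EvenHoles P → y ∉ P → y + 2 * (k * s) ∈ P → Exch P y (y + s) := by
  have hodd : ¬EvenSite (y + s) := by rw [evenSite_add_sign hNs hs]; tauto
  induction k with
  | zero =>
    intro P _ hyP hk
    exact absurd (by simpa using hk) hyP
  | succ k ih =>
    intro P hP hyP hk
    by_cases h2 : y + 2 * s ∈ P
    · have hs' : -s = 1 ∨ -s = -1 := by
        rcases hs with rfl | rfl
        · exact Or.inr rfl
        · exact Or.inl (neg_neg 1)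
      have he1 : y + 2 * s + -s = y + s := by ring
      have he2 : y + 2 * s + 2 * -s = y := by ring
      have := exch_of_hole hNs hs' hP h2 (by rwa [he2])
      rw [he1, he2] at this
      exact this.symm
    by_cases hk0 : y + 2 * (k * s) ∈ P
    · exact ih P hP hyP hk0
    set x := y + 2 * (k * s) with hx
    have hxeven : EvenSite x := (evenSite_add_two_mul hNs y _).mpr hy
    have hx2 : x + 2 * s ∈ P := by
      convert hk using 1
      rw [hx]
      push_cast
      ring
    have hx2even : EvenSite (x + 2 * s) := hP _ hx2
    have hyx : y ≠ x := fun hc => h2 (hc ▸ hx2)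
    have hyx2 : y ≠ x + 2 * s := fun hc => hyP (hc ▸ hx2)
    have hσy : Equiv.swap x (x + 2 * s) y = y := Equiv.swap_apply_of_ne_of_ne hyx hyx2
    have hσys : Equiv.swap x (x + 2 * s) (y + s) = y + s :=
      Equiv.swap_apply_of_ne_of_ne (fun hc => hodd (hc ▸ hxeven)) (fun hc => hodd (hc ▸ hx2even))
    have := ih (Equiv.swap x (x + 2 * s) ⁻¹' P) (hP.preimage_swap hxeven hx2even)
      (by rwa [Set.mem_preimage, hσy]) (by rwa [Set.mem_preimage, Equiv.swap_apply_left])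
    have := this.transport hNs hs hP hxeven (Or.inr hx2)
    rwa [hσy, hσys] at this

theorem exch_even_odd (hNs : Even Ns) {s : ZMod Ns} (hs : s = 1 ∨ s = -1)
    {P : Set (ZMod Ns)} (hP : EvenHoles P) (hne : P.Nonempty) {y : ZMod Ns} (hy : EvenSite y)
    (hyP : y ∉ P) : Exch P y (y + s) := by
  obtain ⟨p, hp⟩ := hne
  have hpe := hP p hp
  rcases hs with rfl | rfl
  · obtain ⟨k, hk⟩ := exists_eq_add_two_mul hNs (iff_of_true hy hpe)
    exact exch_even_odd_of_hole_at hNs (Or.inl rfl) hy k P hP hyP (by rwa [mul_one, ← hk])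
  · obtain ⟨k, hk⟩ := exists_eq_add_two_mul hNs (iff_of_true hpe hy)
    refine exch_even_odd_of_hole_at hNs (Or.inr rfl) hy k P hP hyP ?_
    convert hp using 1
    rw [hk]
    ring

theorem exch_across_hole_of_electron_at (hNs : Even Ns) {h : ZMod Ns} (k : ℕ) :
    ∀ P : Set (ZMod Ns), EvenHoles P → h ∈ P → h + 2 * k ∉ P → Exch P (h - 1) (h + 1) := by
  induction k with
  | zero =>
    intro P _ hh hk
    exact absurd hh (by simpa using hk)
  | succ k ih =>
    intro P hP hh hk
    have heven := hP h hh
    have hodd1 : ¬EvenSite (h + 1) := by rw [evenSite_add_one hNs]; tauto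
    have hodd2 : ¬EvenSite (h - 1) := by rw [evenSite_sub_one hNs]; tauto
    by_cases hx0 : h + 2 * k ∈ P
    swap
    · exact ih P hP hh hx0
    set x := h + 2 * (k : ZMod Ns) with hx
    have hxeven : EvenSite x := hP _ hx0
    have hx2even : EvenSite (x + 2 * 1) := (evenSite_add_two_mul hNs x 1).mpr hxeven
    have hx2 : x + 2 * 1 ∉ P := by
      convert hk using 2
      rw [hx]
      push_cast
      ring
    have hfix : ∀ z, ¬EvenSite z → Equiv.swap x (x + 2 * 1) z = z := fun z hz =>
      Equiv.swap_apply_of_ne_of_ne (fun hc => hz (hc ▸ hxeven)) (fun hc => hz (hc ▸ hx2even))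
    have hP' := hP.preimage_swap hxeven hx2even
    by_cases hxh : x = h
    · have h1 : Exch (Equiv.swap x (x + 2 * 1) ⁻¹' P) x (x + -1) := by
        refine exch_even_odd hNs (Or.inr rfl) hP' ⟨x + 2 * 1, ?_⟩ hxeven ?_
        · rwa [Set.mem_preimage, Equiv.swap_apply_right]
        · rwa [Set.mem_preimage, Equiv.swap_apply_left]
      have h2 := h1.transport hNs (Or.inl rfl) hP hxeven (Or.inl hx0)
      have h3 : Exch P (x + 2 * 1) (x + 2 * 1 + -1) :=
        exch_even_odd hNs (Or.inr rfl) hP ⟨h, hh⟩ hx2even hx2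
      rw [Equiv.swap_apply_left, hxh, ← sub_eq_add_neg, ← hxh, hfix _ (hxh.symm ▸ hodd2)] at h2
      have h4 := h2.symm.trans h3
      rw [show x + 2 * 1 + -1 = x + 1 by ring, hxh] at h4
      exact h4
    · have hσh : Equiv.swap x (x + 2 * 1) h = h :=
        Equiv.swap_apply_of_ne_of_ne (Ne.symm hxh) (fun hc => hx2 (hc ▸ hh))
      have h1 := ih _ hP' (by rwa [Set.mem_preimage, hσh])
        (by rwa [Set.mem_preimage, Equiv.swap_apply_left])
      have h2 := h1.transport hNs (Or.inl rfl) hP hxeven (Or.inl hx0)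
      rwa [hfix _ hodd1, hfix _ hodd2] at h2

/-- All spins can be exchanged as soon as there are a hole and an electron on even sites. -/
theorem exch_of_evenHoles (hNs : Even Ns) {P : Set (ZMod Ns)} (hP : EvenHoles P)
    (hne : P.Nonempty) {e : ZMod Ns} (he : EvenSite e) (heP : e ∉ P) {a b : ZMod Ns}
    (ha : a ∉ P) (hb : b ∉ P) : Exch P a b := by
  have hnotMem : ∀ z, ¬EvenSite z → z ∉ P := fun z hz hc => hz (hP z hc)
  have hstep : ∀ z, ¬EvenSite z → Exch P z (z + 2) := by
    intro z hz
    have hz1 : EvenSite (z + 1) := by rw [evenSite_add_one hNs]; exact hz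
    have e1 : z + 1 - 1 = z := by ring
    have e2 : z + 1 + 1 = z + 2 := by ring
    have e3 : z + 1 + -1 = z := by ring
    by_cases hzP : z + 1 ∈ P
    · obtain ⟨k, hk⟩ := exists_eq_add_two_mul hNs (iff_of_true hz1 he)
      have := exch_across_hole_of_electron_at hNs k P hP hzP (hk ▸ heP)
      rwa [e1, e2] at this
    · have h1 := exch_even_odd hNs (Or.inl rfl) hP hne hz1 hzP
      have h2 := exch_even_odd hNs (Or.inr rfl) hP hne hz1 hzP
      rw [e2] at h1
      rw [e3] at h2
      exact h2.symm.trans h1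
  have hwalk : ∀ z, ¬EvenSite z → ∀ k : ℕ, Exch P z (z + 2 * k) := by
    intro z hz k
    induction k with
    | zero => simpa using Exch.refl (hnotMem z hz)
    | succ k ih =>
      have := ih.trans (hstep _ (by rwa [evenSite_add_two_mul hNs]))
      convert this using 1
      push_cast
      ring
  have hodd : ∀ z ∉ P, ∃ w, ¬EvenSite w ∧ Exch P z w := by
    intro z hz
    by_cases hze : EvenSite z
    · exact ⟨z + 1, by rw [evenSite_add_one hNs]; tauto,
        exch_even_odd hNs (Or.inl rfl) hP hne hze hz⟩
    · exact ⟨z, hze, Exch.refl hz⟩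
  obtain ⟨a', ha', haa'⟩ := hodd a ha
  obtain ⟨b', hb', hbb'⟩ := hodd b hb
  obtain ⟨k, rfl⟩ := exists_eq_add_two_mul hNs (iff_of_false ha' hb')
  exact (haa'.trans (hwalk a' ha' k)).trans hbb'.symm

theorem card_holes (ω : ChainCfg Ns) :
    (Finset.univ.filter fun x : ZMod Ns => ω x = none).card + occNum ω = Ns := by
  have := Finset.card_filter_add_card_filter_not (s := (Finset.univ : Finset (ZMod Ns)))
    (fun x => ω x = none)
  rwa [Finset.card_univ, ZMod.card] at this

theorem card_down (ω : ChainCfg Ns) :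
    upNum ω + (Finset.univ.filter fun x : ZMod Ns => ω x = some false).card = occNum ω := by
  classical
  rw [upNum, ← Finset.card_union_of_disjoint, ← Finset.filter_or, occNum]
  · congr 1
    ext x
    simp only [Finset.mem_filter, Finset.mem_univ, true_and]
    rcases ω x with _ | _ | _ <;> simp
  · refine Finset.disjoint_filter.mpr fun x _ h1 h2 => ?_
    rw [h1] at h2
    simp at h2

theorem card_filter_eq (ω₁ ω₂ : ChainCfg Ns) (hocc : occNum ω₁ = occNum ω₂)
    (hup : upNum ω₁ = upNum ω₂) (v : Option Bool) :
    (Finset.univ.filter fun x : ZMod Ns => ω₁ x = v).card =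
      (Finset.univ.filter fun x : ZMod Ns => ω₂ x = v).card := by
  have h1 := card_holes ω₁
  have h2 := card_holes ω₂
  have h3 := card_down ω₁
  have h4 := card_down ω₂
  rcases v with _ | _ | _
  · omega
  · omega
  · exact hup

theorem exists_hole {ω : ChainCfg Ns} (h : occNum ω < Ns) : (holes ω).Nonempty := by
  have := card_holes ω
  obtain ⟨x, hx⟩ := Finset.card_pos.mp
    (by omega : 0 < (Finset.univ.filter fun x : ZMod Ns => ω x = none).card)
  exact ⟨x, (Finset.mem_filter.mp hx).2⟩

/-- If all sites of one parity are empty, then at most half of the sites are occupied. -/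
theorem exists_electron (hNs : Even Ns) {ω : ChainCfg Ns} (h : Ns < 2 * occNum ω) (p : Prop) :
    ∃ x, (EvenSite x ↔ p) ∧ x ∉ holes ω := by
  by_contra! hc
  have hle : occNum ω ≤ (Finset.univ.filter fun x : ZMod Ns => ω x = none).card := by
    refine Finset.card_le_card_of_injOn (fun x => x + 1) ?_ (add_left_injective 1).injOn
    intro x hx
    simp only [Finset.coe_filter, Finset.mem_univ, true_and, Set.mem_ofPred_eq] at hx ⊢
    refine hc _ ?_
    have h1 := evenSite_add_one hNs x
    have h2 : ¬(EvenSite x ↔ p) := fun h => hx (hc x h)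
    tauto
  have := card_holes ω
  omega

theorem conn_swap_adjacent_even (hNs : Even Ns) {ω : ChainCfg Ns} (h1 : occNum ω < Ns)
    (h2 : Ns < 2 * occNum ω) (hω : EvenHoles (holes ω)) {x : ZMod Ns} (hx : EvenSite x) :
    Conn ω (ω ∘ Equiv.swap x (x + 2 * 1)) := by
  by_cases hh : x ∈ holes ω ∨ x + 2 * 1 ∈ holes ω
  · exact conn_swap_nnn hNs (Or.inl rfl) hω hx hh
  · rw [not_or] at hh
    obtain ⟨e, he, heω⟩ := exists_electron hNs h2 True
    exact (exch_of_evenHoles hNs hω (exists_hole h1) (by simpa using he) heω hh.1 hh.2).2.2 ω rfl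

theorem conn_swap_even (hNs : Even Ns) {ω : ChainCfg Ns} (h1 : occNum ω < Ns)
    (h2 : Ns < 2 * occNum ω) (hω : EvenHoles (holes ω)) {a b : ZMod Ns} (ha : EvenSite a)
    (hb : EvenSite b) : Conn ω (ω ∘ Equiv.swap a b) := by
  obtain ⟨k, rfl⟩ := exists_eq_add_two_mul hNs (iff_of_true ha hb)
  clear hb
  induction k generalizing ω with
  | zero => simpa using Conn.refl ω
  | succ k ih =>
    set x := a + 2 * (k : ZMod Ns) with hx
    have hxe : EvenSite x := (evenSite_add_two_mul hNs a _).mpr ha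
    have hx2e : EvenSite (x + 2 * 1) := (evenSite_add_two_mul hNs x _).mpr hxe
    have hcast : a + 2 * ((k + 1 : ℕ) : ZMod Ns) = x + 2 * 1 := by
      rw [hx]
      push_cast
      ring
    rw [hcast]
    by_cases hax : a = x
    · rw [hax]
      exact conn_swap_adjacent_even hNs h1 h2 hω hxe
    by_cases hax2 : a = x + 2 * 1
    · rw [← hax2, Equiv.swap_self]
      exact Conn.refl ω
    set ω1 := ω ∘ Equiv.swap x (x + 2 * 1) with hω1
    set ω2 := ω1 ∘ Equiv.swap a x with hω2
    have hocc1 : occNum ω1 = occNum ω := occNum_comp_perm ω _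
    have hocc2 : occNum ω2 = occNum ω := (occNum_comp_perm ω1 _).trans hocc1
    have hev1 : EvenHoles (holes ω1) := hω.preimage_swap hxe hx2e
    have hev2 : EvenHoles (holes ω2) := hev1.preimage_swap ha hxe
    have c1 : Conn ω ω1 := conn_swap_adjacent_even hNs h1 h2 hω hxe
    have c2 : Conn ω1 ω2 := ih (hocc1 ▸ h1) (hocc1 ▸ h2) hev1
    have c3 := conn_swap_adjacent_even hNs (hocc2 ▸ h1) (hocc2 ▸ h2) hev2 hxe
    have hcomp : ω2 ∘ Equiv.swap x (x + 2 * 1) = ω ∘ Equiv.swap a (x + 2 * 1) := by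
      rw [Equiv.swap_comm a (x + 2 * 1), ← Equiv.swap_mul_swap_mul_swap hax hax2]
      rfl
    rw [hcomp] at c3
    exact (c1.trans c2).trans c3

theorem conn_of_evenHoles (hNs : Even Ns) {ω₁ ω₂ : ChainCfg Ns} (h1 : occNum ω₁ < Ns)
    (h2 : Ns < 2 * occNum ω₁) (hω₁ : EvenHoles (holes ω₁)) (hω₂ : EvenHoles (holes ω₂))
    (hocc : occNum ω₁ = occNum ω₂) (hup : upNum ω₁ = upNum ω₂) : Conn ω₁ ω₂ := by
  classical
  induction hd : (Finset.univ.filter fun x : ZMod Ns => ω₁ x ≠ ω₂ x).card using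
    Nat.strong_induction_on generalizing ω₁ with
  | _ d ih =>
    by_cases heq : ω₁ = ω₂
    · exact heq ▸ Conn.refl ω₁
    have hx : ∃ x, ω₁ x ≠ ω₂ x ∧ (ω₂ x = none ∨ holes ω₁ = holes ω₂) := by
      by_cases hsub : holes ω₂ ⊆ holes ω₁
      · obtain ⟨x, hx⟩ := Function.ne_iff.mp heq
        refine ⟨x, hx, Or.inr ?_⟩
        have hle : (Finset.univ.filter fun x : ZMod Ns => ω₂ x = none) =
            Finset.univ.filter fun x : ZMod Ns => ω₁ x = none := by
          refine Finset.eq_of_subset_of_card_le (fun z hz => ?_)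
            (card_filter_eq ω₁ ω₂ hocc hup none).le
          simp only [Finset.mem_filter, Finset.mem_univ, true_and] at hz ⊢
          exact hsub hz
        ext z
        have := Finset.ext_iff.mp hle z
        simp only [Finset.mem_filter, Finset.mem_univ, true_and] at this
        exact this.symm
      · obtain ⟨x, hx2, hx1⟩ := Set.not_subset.mp hsub
        exact ⟨x, fun hc => hx1 (hc.trans hx2), Or.inl hx2⟩
    obtain ⟨x, hx, hcase⟩ := hx
    obtain ⟨y, hy1, hy2⟩ : ∃ y, ω₁ y = ω₂ x ∧ ω₂ y ≠ ω₂ x := by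
      by_contra! hc
      have hss : (Finset.univ.filter fun z : ZMod Ns => ω₁ z = ω₂ x) ⊂
          Finset.univ.filter fun z : ZMod Ns => ω₂ z = ω₂ x := by
        refine Finset.ssubset_iff_of_subset (fun z hz => ?_) |>.mpr ⟨x, ?_, ?_⟩
        · simp only [Finset.mem_filter, Finset.mem_univ, true_and] at hz ⊢
          exact hc z hz
        · simp
        · simpa using hx
      exact (Finset.card_lt_card hss).ne (card_filter_eq ω₁ ω₂ hocc hup _)
    have hstep : Conn ω₁ (ω₁ ∘ Equiv.swap x y) ∧ EvenHoles (holes (ω₁ ∘ Equiv.swap x y)) := by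
      by_cases hxn : ω₂ x = none
      · have hxe : EvenSite x := hω₂ x hxn
        have hye : EvenSite y := hω₁ y (hy1.trans hxn)
        exact ⟨conn_swap_even hNs h1 h2 hω₁ hxe hye, hω₁.preimage_swap hxe hye⟩
      · have hholes := hcase.resolve_left hxn
        have hx1 : x ∉ holes ω₁ := hholes ▸ hxn
        have hy1' : y ∉ holes ω₁ := fun hc => hxn (hy1.symm.trans hc)
        obtain ⟨e, he, heω⟩ := exists_electron hNs h2 True
        refine ⟨(exch_of_evenHoles hNs hω₁ (exists_hole h1) (by simpa using he) heω hx1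
          hy1').2.2 ω₁ rfl, ?_⟩
        rwa [holes_comp_swap_of_notMem hx1 hy1']
    have hocc' : occNum (ω₁ ∘ Equiv.swap x y) = occNum ω₁ := occNum_comp_perm ω₁ _
    have hup' : upNum (ω₁ ∘ Equiv.swap x y) = upNum ω₁ := upNum_comp_perm ω₁ _
    refine hstep.1.trans (ih _ ?_ (hocc' ▸ h1) (hocc' ▸ h2) hstep.2 (hocc'.trans hocc)
      (hup'.trans hup) rfl)
    rw [← hd]
    refine Finset.card_lt_card (Finset.ssubset_iff_of_subset (fun z hz => ?_) |>.mpr ⟨x, ?_, ?_⟩)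
    · simp only [Finset.mem_filter, Finset.mem_univ, true_and, Function.comp_apply] at hz ⊢
      by_cases hzx : z = x
      · exact hzx ▸ hx
      by_cases hzy : z = y
      · rw [hzy, hy1]
        exact hy2.symm
      rwa [Equiv.swap_apply_of_ne_of_ne hzx hzy] at hz
    · simpa using hx
    · simpa using hy1

/-- All holes can be brought to even sites. -/
theorem exists_conn_evenHoles (hNs : Even Ns) {ω : ChainCfg Ns} (h2 : Ns < 2 * occNum ω)
    (hω : NoAdjHoles ω) : ∃ ω', Conn ω ω' ∧ EvenHoles (holes ω') := by
  classical
  induction hd : (Finset.univ.filter fun x : ZMod Ns => ω x = none ∧ ¬EvenSite x).card using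
    Nat.strong_induction_on generalizing ω with
  | _ d ih =>
    by_cases hev : EvenHoles (holes ω)
    · exact ⟨ω, Conn.refl ω, hev⟩
    obtain ⟨x, hx, hxo, hx2⟩ : ∃ x, x ∈ holes ω ∧ ¬EvenSite x ∧ x + 2 ∉ holes ω := by
      by_contra! hc
      simp only [EvenHoles, not_forall] at hev
      obtain ⟨x, hx, hxo⟩ := hev
      have hall : ∀ k : ℕ, x + 2 * k ∈ holes ω := by
        intro k
        induction k with
        | zero => simpa using hx
        | succ k ih =>
          have := hc _ ih (by rwa [evenSite_add_two_mul hNs])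
          convert this using 1
          push_cast
          ring
      obtain ⟨e, he, heω⟩ := exists_electron hNs h2 False
      obtain ⟨k, rfl⟩ := exists_eq_add_two_mul hNs (iff_of_false hxo (by simpa using he))
      exact heω (hall k)
    have hx1 : x + 1 ∉ holes ω := fun hc => hω x ⟨hx, hc⟩
    have hx1e : EvenSite (x + 1) := by rwa [evenSite_add_one hNs]
    have hne : x ≠ x + 1 := fun hc => hxo (hc ▸ hx1e)
    have hmem : ∀ w, w ∈ holes (ω ∘ Equiv.swap x (x + 1)) →
        w = x + 1 ∨ (w ∈ holes ω ∧ w ≠ x) := by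
      intro w hw
      change Equiv.swap x (x + 1) w ∈ holes ω at hw
      by_cases hw1 : w = x + 1
      · exact Or.inl hw1
      by_cases hw2 : w = x
      · rw [hw2, Equiv.swap_apply_left] at hw
        exact absurd hw hx1
      · rw [Equiv.swap_apply_of_ne_of_ne hw2 hw1] at hw
        exact Or.inr ⟨hw, hw2⟩
    have hs2 : x + 1 + 1 = x + 2 := by ring
    have hadj : NoAdjHoles (ω ∘ Equiv.swap x (x + 1)) := by
      rintro z ⟨hz, hzs⟩
      rcases hmem z hz with rfl | ⟨hz1, hz2⟩ <;> rcases hmem _ hzs with h' | ⟨h1', h2'⟩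
      · exact hne (add_right_cancel h').symm
      · exact hx2 (hs2 ▸ h1')
      · exact hz2 (add_right_cancel h')
      · exact hω z ⟨hz1, h1'⟩
    have hconn : Conn ω (ω ∘ Equiv.swap x (x + 1)) :=
      conn_swap_nn (Or.inl rfl) hω hadj ⟨fun _ => hx1, fun _ => hx⟩
    obtain ⟨ω', hω', hev'⟩ := ih _ (by
      rw [← hd]
      refine Finset.card_lt_card
        (Finset.ssubset_iff_of_subset (fun z hz => ?_) |>.mpr ⟨x, ?_, ?_⟩)
      · simp only [Finset.mem_filter, Finset.mem_univ, true_and] at hz ⊢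
        rcases hmem z hz.1 with rfl | ⟨hz1, -⟩
        · exact absurd hx1e hz.2
        · exact ⟨hz1, hz.2⟩
      · simpa using ⟨hx, hxo⟩
      · simp only [Finset.mem_filter, Finset.mem_univ, true_and, Function.comp_apply,
          Equiv.swap_apply_left]
        exact fun hc => hx1 hc.1) (by rwa [occNum_comp_perm]) hadj rfl
    exact ⟨ω', hconn.trans hω', hev'⟩

/-- Each magnetization sector is connected. -/
theorem conn_of_upNum_eq (hNs : Even Ns) {ω₁ ω₂ : ChainCfg Ns} (h1 : occNum ω₁ < Ns)
    (h2 : Ns < 2 * occNum ω₁) (hω₁ : NoAdjHoles ω₁) (hω₂ : NoAdjHoles ω₂)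
    (hocc : occNum ω₁ = occNum ω₂) (hup : upNum ω₁ = upNum ω₂) : Conn ω₁ ω₂ := by
  obtain ⟨τ₁, hc₁, hτ₁⟩ := exists_conn_evenHoles hNs h2 hω₁
  obtain ⟨τ₂, hc₂, hτ₂⟩ := exists_conn_evenHoles hNs (hocc ▸ h2) hω₂
  have ho := hc₁.occNum_eq
  refine (hc₁.trans (conn_of_evenHoles hNs (ho ▸ h1) (ho ▸ h2) hτ₁ hτ₂ ?_ ?_)).trans hc₂.symm
  · rw [← hc₁.occNum_eq, ← hc₂.occNum_eq, hocc]
  · rw [← hc₁.upNum_eq, ← hc₂.upNum_eq, hup]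

end Connectivity

section Hamiltonian

variable {Ns Ne : ℕ} [NeZero Ns]

theorem limUVHam_symm (t t' : ℝ) (i j : AllowedCfg Ns Ne) :
    limUVHam Ns Ne t t' i j = limUVHam Ns Ne t t' j i := by
  have h1 : NNHop j.1 i.1 ↔ NNHop i.1 j.1 := ⟨NNHop.symm, NNHop.symm⟩
  have h2 : EvenNNNHop j.1 i.1 ↔ EvenNNNHop i.1 j.1 := ⟨EvenNNNHop.symm, EvenNNNHop.symm⟩
  classical
  exact if_congr h1 rfl (if_congr h2 rfl rfl)

theorem limUVHam_nonpos {t t' : ℝ} (ht : 0 < t) (ht' : 0 < t') (i j : AllowedCfg Ns Ne) :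
    limUVHam Ns Ne t t' i j ≤ 0 := by
  unfold limUVHam
  split_ifs <;> linarith

theorem hop_of_limUVHam_ne_zero {t t' : ℝ} {i j : AllowedCfg Ns Ne}
    (h : limUVHam Ns Ne t t' i j ≠ 0) : Hop j.1 i.1 := by
  unfold limUVHam at h
  split_ifs at h with h1 h2
  · exact Or.inl h1
  · exact Or.inr h2
  · exact absurd rfl h

theorem limUVHam_ne_zero {t t' : ℝ} (ht : 0 < t) (ht' : 0 < t') {i j : AllowedCfg Ns Ne}
    (h : Hop j.1 i.1) : limUVHam Ns Ne t t' i j ≠ 0 := by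
  unfold limUVHam
  rcases h with h | h <;> split_ifs <;> linarith

/-- The configuration with the same occupied sites and all spins down. -/
def flat (ω : ChainCfg Ns) : ChainCfg Ns :=
  fun x => (ω x).map fun _ => false

omit [NeZero Ns] in
theorem flat_eq_none_iff (ω : ChainCfg Ns) (x : ZMod Ns) : flat ω x = none ↔ ω x = none := by
  simp [flat]

omit [NeZero Ns] in
theorem flat_flat (ω : ChainCfg Ns) : flat (flat ω) = flat ω := by
  funext x
  simp [flat]

omit [NeZero Ns] in
theorem eq_none_iff_of_flat_eq {ω ω' : ChainCfg Ns} (h : flat ω = flat ω') (x : ZMod Ns) :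
    ω x = none ↔ ω' x = none := by
  rw [← flat_eq_none_iff, h, flat_eq_none_iff]

theorem allowed_of_flat_eq {ω ω' : ChainCfg Ns} (h : flat ω = flat ω')
    (hω' : occNum ω' = Ne ∧ ∀ x : ZMod Ns, ¬(ω' x = none ∧ ω' (x + 1) = none)) :
    occNum ω = Ne ∧ ∀ x : ZMod Ns, ¬(ω x = none ∧ ω (x + 1) = none) := by
  simpa only [occNum, ne_eq, eq_none_iff_of_flat_eq h] using hω'

/-- `flat` on allowed configurations. -/
def flatten (ω : AllowedCfg Ns Ne) : AllowedCfg Ns Ne :=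
  ⟨flat ω.1, allowed_of_flat_eq (flat_flat ω.1) ω.2⟩

theorem flatten_flatten (ω : AllowedCfg Ns Ne) : flatten (flatten ω) = flatten ω :=
  Subtype.ext (flat_flat ω.1)

omit [NeZero Ns] in
theorem NNHop.flat {ω ω' : ChainCfg Ns} (h : NNHop ω ω') : NNHop (flat ω) (flat ω') := by
  rw [nnHop_iff] at h ⊢
  obtain ⟨x, hx, rfl⟩ := h
  exact ⟨x, by simpa only [ne_eq, flat_eq_none_iff] using hx, rfl⟩

theorem EvenNNNHop.flat {ω ω' : ChainCfg Ns} (h : EvenNNNHop ω ω') :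
    EvenNNNHop (flat ω) (flat ω') := by
  rw [evenNNNHop_iff] at h ⊢
  obtain ⟨x, hx0, hx, rfl⟩ := h
  exact ⟨x, hx0, by simpa only [ne_eq, flat_eq_none_iff] using hx, rfl⟩

omit [NeZero Ns] in
theorem NNHop.exists_lift {ω d : ChainCfg Ns} (h : NNHop d (_root_.flat ω)) :
    ∃ ω', _root_.flat ω' = d ∧ NNHop ω' ω := by
  obtain ⟨x, hx, hd⟩ := (nnHop_iff _ _).mp h.symm
  refine ⟨ω ∘ Equiv.swap x (x + 1), hd.symm, NNHop.symm ((nnHop_iff _ _).mpr ⟨x, ?_, rfl⟩)⟩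
  simpa only [ne_eq, flat_eq_none_iff] using hx

theorem EvenNNNHop.exists_lift {ω d : ChainCfg Ns} (h : EvenNNNHop d (_root_.flat ω)) :
    ∃ ω', _root_.flat ω' = d ∧ EvenNNNHop ω' ω := by
  obtain ⟨x, hx0, hx, hd⟩ := (evenNNNHop_iff _ _).mp h.symm
  refine ⟨ω ∘ Equiv.swap x (x + 2), hd.symm,
    EvenNNNHop.symm ((evenNNNHop_iff _ _).mpr ⟨x, hx0, ?_, rfl⟩)⟩
  simpa only [ne_eq, flat_eq_none_iff] using hx

/-- A hop is determined by its starting configuration and the final set of empty sites. -/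
theorem Hop.eq_of_flat_eq {ω ω₁ ω₂ : ChainCfg Ns} (h₁ : Hop ω ω₁) (h₂ : Hop ω ω₂)
    (h : flat ω₁ = flat ω₂) : ω₁ = ω₂ := by
  obtain ⟨x, y, hxy, rfl⟩ := h₁.exists_swap
  obtain ⟨u, v, huv, rfl⟩ := h₂.exists_swap
  have hiff : ∀ z, ω (Equiv.swap x y z) = none ↔ ω (Equiv.swap u v z) = none :=
    eq_none_iff_of_flat_eq h
  have hx : x = u ∨ x = v := by
    by_contra! hc
    have := hiff x
    rw [Equiv.swap_apply_left, Equiv.swap_apply_of_ne_of_ne hc.1 hc.2] at this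
    tauto
  have hy : y = u ∨ y = v := by
    by_contra! hc
    have := hiff y
    rw [Equiv.swap_apply_right, Equiv.swap_apply_of_ne_of_ne hc.1 hc.2] at this
    tauto
  have hne : x ≠ y := by
    rintro rfl
    tauto
  rcases hx with rfl | rfl <;> rcases hy with rfl | rfl
  · exact absurd rfl hne
  · rfl
  · rw [Equiv.swap_comm]
  · exact absurd rfl hne

open Classical in
/-- Summing over the spins of the initial configuration yields the spinless Hamiltonian. -/
theorem sum_limUVHam_flatten (t t' : ℝ) (ω d : AllowedCfg Ns Ne) (hd : flatten d = d) :
    ∑ ω' with flatten ω' = d, limUVHam Ns Ne t t' ω ω' =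
      limUVHam Ns Ne t t' (flatten ω) d := by
  have hlift : ∀ {η : ChainCfg Ns}, flat η = d.1 →
      ∃ ω' : AllowedCfg Ns Ne, flatten ω' = d ∧ ω'.1 = η := fun {η} hη =>
    ⟨⟨η, allowed_of_flat_eq (hη.trans (congrArg Subtype.val hd).symm) d.2⟩, Subtype.ext hη, rfl⟩
  by_cases hhop : ∃ ω' : AllowedCfg Ns Ne, flatten ω' = d ∧ Hop ω'.1 ω.1
  · obtain ⟨ω', hω', hop⟩ := hhop
    have huniq : ∀ ω'' : AllowedCfg Ns Ne, flatten ω'' = d → Hop ω''.1 ω.1 → ω'' = ω' :=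
      fun ω'' h1 h2 => Subtype.ext (h2.symm.eq_of_flat_eq hop.symm
        (congrArg Subtype.val (h1.trans hω'.symm)))
    have hval : flat ω'.1 = d.1 := congrArg Subtype.val hω'
    have h1 : NNHop d.1 (flatten ω).1 ↔ NNHop ω'.1 ω.1 := by
      refine ⟨fun h => ?_, fun h => hval ▸ h.flat⟩
      obtain ⟨η, hη, hηω⟩ := h.exists_lift
      obtain ⟨ω'', hω'', rfl⟩ := hlift hη
      exact huniq ω'' hω'' (Or.inl hηω) ▸ hηω
    have h2 : EvenNNNHop d.1 (flatten ω).1 ↔ EvenNNNHop ω'.1 ω.1 := by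
      refine ⟨fun h => ?_, fun h => hval ▸ h.flat⟩
      obtain ⟨η, hη, hηω⟩ := h.exists_lift
      obtain ⟨ω'', hω'', rfl⟩ := hlift hη
      exact huniq ω'' hω'' (Or.inr hηω) ▸ hηω
    rw [Finset.sum_eq_single ω']
    · exact if_congr h1.symm rfl (if_congr h2.symm rfl rfl)
    · intro ω'' hmem hne
      by_contra hc
      exact hne (huniq ω'' (Finset.mem_filter.mp hmem).2 (hop_of_limUVHam_ne_zero hc))
    · intro hmem
      simp [hω'] at hmem
  · rw [Finset.sum_eq_zero]
    · symm
      by_contra hc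
      apply hhop
      rcases hop_of_limUVHam_ne_zero hc with h | h
      · obtain ⟨η, hη, hηω⟩ := h.exists_lift
        obtain ⟨ω'', hω'', rfl⟩ := hlift hη
        exact ⟨ω'', hω'', Or.inl hηω⟩
      · obtain ⟨η, hη, hηω⟩ := h.exists_lift
        obtain ⟨ω'', hω'', rfl⟩ := hlift hη
        exact ⟨ω'', hω'', Or.inr hηω⟩
    · intro ω'' hmem
      by_contra hc
      exact hhop ⟨ω'', (Finset.mem_filter.mp hmem).2, hop_of_limUVHam_ne_zero hc⟩

/-- The spins of an allowed configuration can be chosen with any magnetization. -/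
theorem exists_flatten_eq_upNum_eq (ω : AllowedCfg Ns Ne) {n : ℕ} (hn : n ≤ Ne) :
    ∃ ω' : AllowedCfg Ns Ne, flatten ω' = flatten ω ∧ upNum ω'.1 = n := by
  classical
  obtain ⟨S, hS, hcard⟩ := Finset.exists_subset_card_eq
    (s := Finset.univ.filter fun x : ZMod Ns => ω.1 x ≠ none) (n := n) (hn.trans_eq ω.2.1.symm)
  let η : ChainCfg Ns := fun x => if x ∈ S then some true else flat ω.1 x
  have hη : flat η = flat ω.1 := by
    funext x
    by_cases hx : x ∈ S
    · have hne := (Finset.mem_filter.mp (hS hx)).2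
      obtain ⟨b, hb⟩ := Option.ne_none_iff_exists'.mp hne
      simp [flat, η, hx, hb]
    · simp [flat, η, hx]
  refine ⟨⟨η, allowed_of_flat_eq hη ω.2⟩, Subtype.ext hη, ?_⟩
  rw [← hcard, upNum]
  congr 1
  ext x
  simp only [Finset.mem_filter, Finset.mem_univ, true_and]
  by_cases hx : x ∈ S
  · simp [η, hx]
  · simp [η, hx, flat]

theorem nonempty_allowedCfg (hNs : Even Ns) (hNe1 : Ns < 2 * Ne) (hNe2 : Ne < Ns) :
    Nonempty (AllowedCfg Ns Ne) := by
  classical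
  let κ : ChainCfg Ns := fun x => if EvenSite x then none else some false
  have hκ : 2 * occNum κ ≤ Ns := by
    by_contra! hc
    obtain ⟨x, hx, hxκ⟩ := exists_electron hNs hc True
    exact hxκ (if_pos (by simpa using hx))
  have hcount := card_holes κ
  obtain ⟨S, hS, hcard⟩ := Finset.exists_subset_card_eq
    (s := Finset.univ.filter fun x : ZMod Ns => κ x = none) (n := Ns - Ne) (by omega)
  let ω : ChainCfg Ns := fun x => if x ∈ S then none else some false
  have hmem : ∀ x, ω x = none ↔ x ∈ S := fun x => by simp [ω]
  have hocc := card_holes ω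
  have hS' : (Finset.univ.filter fun x : ZMod Ns => ω x = none) = S := by
    ext x
    simp [hmem]
  rw [hS', hcard] at hocc
  refine ⟨⟨ω, by omega, EvenHoles.noAdjHoles hNs fun x hx => ?_⟩⟩
  have := (Finset.mem_filter.mp (hS ((hmem x).mp hx))).2
  by_contra hxe
  simp [κ, hxe] at this

/-- The Hamiltonian has a positive eigenvector. -/
theorem exists_pos_eigenvector (hNs : Even Ns) (hNe1 : Ns < 2 * Ne) (hNe2 : Ne < Ns)
    {t t' : ℝ} (ht : 0 < t) (ht' : 0 < t') :
    ∃ (E : ℝ) (ψ : AllowedCfg Ns Ne → ℝ), (∀ ω, 0 < ψ ω) ∧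
      (limUVHam Ns Ne t t').mulVec ψ = E • ψ := by
  classical
  let D := {d : AllowedCfg Ns Ne // flatten d = d}
  let π : AllowedCfg Ns Ne → D := fun ω => ⟨flatten ω, flatten_flatten ω⟩
  obtain ⟨ω₀⟩ := nonempty_allowedCfg hNs hNe1 hNe2
  have : Nonempty D := ⟨π ω₀⟩
  obtain ⟨E, v, hv0, hvnn, hE⟩ := exists_nonneg_eigenvector
    ((limUVHam Ns Ne t t').submatrix (Subtype.val : D → _) Subtype.val)
    (fun i j => limUVHam_symm t t' _ _) (fun i j => limUVHam_nonpos ht ht' _ _)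
  have hψE : (limUVHam Ns Ne t t').mulVec (v ∘ π) = E • (v ∘ π) := by
    funext ω
    have h := congrFun hE (π ω)
    simp only [Matrix.mulVec, dotProduct, Matrix.submatrix_apply, Pi.smul_apply,
      Function.comp_apply] at h ⊢
    rw [← h, ← Finset.sum_fiberwise (s := Finset.univ) (g := π)]
    refine Finset.sum_congr rfl fun d _ => ?_
    rw [← sum_limUVHam_flatten t t' ω d.1 d.2, Finset.sum_mul]
    refine Finset.sum_congr ?_ fun ω' hω' => ?_
    · ext ω'
      simp only [Finset.mem_filter, Finset.mem_univ, true_and]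
      exact ⟨fun h => congrArg Subtype.val h, fun h => Subtype.ext h⟩
    · have hπ : flatten ω' = d.1 := (Finset.mem_filter.mp hω').2
      rw [show π ω' = d from Subtype.ext hπ]
  refine ⟨E, v ∘ π, fun ω => ?_, hψE⟩
  refine lt_of_le_of_ne (hvnn _) fun hzero => hv0 (funext fun d => ?_)
  obtain ⟨ω', hω', hup⟩ := exists_flatten_eq_upNum_eq d.1
    (n := upNum ω.1) ((upNum_le_occNum ω.1).trans_eq ω.2.1)
  have hconn : Conn ω.1 ω'.1 := conn_of_upNum_eq hNs (ω.2.1.trans_lt hNe2)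
    (by rw [ω.2.1]; exact hNe1) ω.2.2 ω'.2.2 (ω.2.1.trans ω'.2.1.symm) hup.symm
  have hinv := hconn.apply_eq (fun η : AllowedCfg Ns Ne => (v ∘ π) η = 0) fun a b hab =>
    propext ⟨fun h => eq_zero_of_nonneg_eigenvector _ (limUVHam_nonpos ht ht')
      (fun i => hvnn _) hψE (limUVHam_ne_zero ht ht' hab.symm) h,
    fun h => eq_zero_of_nonneg_eigenvector _ (limUVHam_nonpos ht ht')
      (fun i => hvnn _) hψE (limUVHam_ne_zero ht ht' hab) h⟩
  have h0 : (v ∘ π) ω' = 0 := hinv.mp hzero.symm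
  rwa [Function.comp_apply, show π ω' = d from Subtype.ext (hω'.trans d.2)] at h0

/-- Multiplying an eigenvector by a function of the magnetization yields an eigenvector. -/
theorem mulVec_mul_upNum {t t' E : ℝ} {ψ : AllowedCfg Ns Ne → ℝ}
    (hE : (limUVHam Ns Ne t t').mulVec ψ = E • ψ) (g : ℕ → ℝ) :
    (limUVHam Ns Ne t t').mulVec (fun ω => g (upNum ω.1) * ψ ω) =
      E • fun ω => g (upNum ω.1) * ψ ω := by
  funext ω
  have h := congrFun hE ω
  simp only [Matrix.mulVec, dotProduct, Pi.smul_apply, smul_eq_mul] at h ⊢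
  rw [mul_left_comm, ← h, Finset.mul_sum]
  refine Finset.sum_congr rfl fun ω' _ => ?_
  by_cases h0 : limUVHam Ns Ne t t' ω ω' = 0
  · simp [h0]
  · rw [(hop_of_limUVHam_ne_zero h0).upNum_eq]
    ring

end Hamiltonian

/-- **Theorem 7.3: ferromagnetism in the limiting `U`-`V` model.** For even `Ns ≥ 4`,
odd `Ne` with `Ns/2 < Ne < Ns` and `t, t' > 0`, there is a single value `E` such that,
for each magnetization sector `n ∈ {0, …, Ne}`, `E` is the smallest eigenvalue of the
restriction of the Hamiltonian to the sector and this lowest eigenvalue is simple;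
moreover `E` is the ground-state energy and the full ground-state eigenspace has
dimension exactly `Ne + 1`. -/
theorem limitingUV_ferromagnetism (Ns Ne : ℕ) [NeZero Ns] (hNs : 4 ≤ Ns)
    (hNsEven : Even Ns) (hNe1 : Ns < 2 * Ne) (hNe2 : Ne < Ns) (hodd : Odd Ne)
    (t t' : ℝ) (ht : 0 < t) (ht' : 0 < t') :
    ∃ E : ℝ,
      (∀ n : ℕ, n ≤ Ne →
        ∃ Φ₀ : AllowedCfg Ns Ne → ℝ, Φ₀ ≠ 0 ∧
          (∀ ω, upNum ω.1 ≠ n → Φ₀ ω = 0) ∧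
          (limUVHam Ns Ne t t').mulVec Φ₀ = E • Φ₀ ∧
          IsLeast {μ : ℝ | ∃ Φ : AllowedCfg Ns Ne → ℝ, Φ ≠ 0 ∧
            (∀ ω, upNum ω.1 ≠ n → Φ ω = 0) ∧
            (limUVHam Ns Ne t t').mulVec Φ = μ • Φ} E ∧
          (∀ Φ : AllowedCfg Ns Ne → ℝ, (∀ ω, upNum ω.1 ≠ n → Φ ω = 0) →
            (limUVHam Ns Ne t t').mulVec Φ = E • Φ → ∃ c : ℝ, Φ = c • Φ₀)) ∧
      IsLeast {μ : ℝ | ∃ Φ : AllowedCfg Ns Ne → ℝ, Φ ≠ 0 ∧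
        (limUVHam Ns Ne t t').mulVec Φ = μ • Φ} E ∧
      Module.finrank ℝ
        (Module.End.eigenspace (limUVHam Ns Ne t t').mulVecLin E) = Ne + 1 := by
  obtain ⟨E, ψ, hψ, hE⟩ := exists_pos_eigenvector hNsEven hNe1 hNe2 ht ht'
  have hleast : ∀ (μ : ℝ) (Φ : AllowedCfg Ns Ne → ℝ), Φ ≠ 0 →
      (limUVHam Ns Ne t t').mulVec Φ = μ • Φ → E ≤ μ := fun μ Φ h0 h =>
    le_of_pos_eigenvector _ (limUVHam_symm t t') (limUVHam_nonpos ht ht') hψ hE h h0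
  have hratio : ∀ Φ : AllowedCfg Ns Ne → ℝ, (limUVHam Ns Ne t t').mulVec Φ = E • Φ →
      ∀ ω ω' : AllowedCfg Ns Ne, upNum ω.1 = upNum ω'.1 → Φ ω / ψ ω = Φ ω' / ψ ω' := by
    intro Φ hΦ ω ω' hup
    refine Conn.apply_eq (fun η => Φ η / ψ η) (fun a b hab => ?_)
      (conn_of_upNum_eq hNsEven (ω.2.1.trans_lt hNe2) (by rw [ω.2.1]; exact hNe1)
        ω.2.2 ω'.2.2 (ω.2.1.trans ω'.2.1.symm) hup)
    exact div_eq_div_of_eigenvector _ (limUVHam_symm t t') (limUVHam_nonpos ht ht') hψ hE hΦ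
      (limUVHam_ne_zero ht ht' hab.symm)
  obtain ⟨ω₀⟩ := nonempty_allowedCfg (Ne := Ne) hNsEven hNe1 hNe2
  have hsector : ∀ n ≤ Ne, ∃ ω : AllowedCfg Ns Ne, upNum ω.1 = n := fun n hn =>
    let ⟨ω, _, hω⟩ := exists_flatten_eq_upNum_eq ω₀ hn
    ⟨ω, hω⟩
  refine ⟨E, fun n hn => ?_, ⟨⟨ψ, ?_, hE⟩, ?_⟩, ?_⟩
  · obtain ⟨ω₁, hω₁⟩ := hsector n hn
    set Φ₀ : AllowedCfg Ns Ne → ℝ := fun ω => (if upNum ω.1 = n then 1 else 0) * ψ ω with hΦ₀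
    have h0 : Φ₀ ≠ 0 := fun h => (hψ ω₁).ne' (by simpa [hΦ₀, hω₁] using congrFun h ω₁)
    have hsupp : ∀ ω, upNum ω.1 ≠ n → Φ₀ ω = 0 := fun ω h => by simp [hΦ₀, h]
    have heig : (limUVHam Ns Ne t t').mulVec Φ₀ = E • Φ₀ :=
      mulVec_mul_upNum hE fun m => if m = n then 1 else 0
    refine ⟨Φ₀, h0, hsupp, heig, ⟨⟨Φ₀, h0, hsupp, heig⟩, ?_⟩, fun Φ hΦ hΦE => ?_⟩
    · rintro μ ⟨Φ, hΦ0, -, hΦ⟩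
      exact hleast μ Φ hΦ0 hΦ
    · refine ⟨Φ ω₁ / ψ ω₁, funext fun ω => ?_⟩
      by_cases hω : upNum ω.1 = n
      · have := hratio Φ hΦE ω ω₁ (hω.trans hω₁.symm)
        rw [Pi.smul_apply, smul_eq_mul, ← this, hΦ₀]
        simp [hω, div_mul_cancel₀ _ (hψ ω).ne']
      · simp [hΦ ω hω, hsupp ω hω]
  · exact fun h => (hψ ω₀).ne' (congrFun h ω₀)
  · rintro μ ⟨Φ, hΦ0, hΦ⟩
    exact hleast μ Φ hΦ0 hΦ
  · have hlt : ∀ ω : AllowedCfg Ns Ne, upNum ω.1 < Ne + 1 := fun ω =>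
      Nat.lt_succ_of_le ((upNum_le_occNum ω.1).trans_eq ω.2.1)
    let L : (Fin (Ne + 1) → ℝ) →ₗ[ℝ] (AllowedCfg Ns Ne → ℝ) :=
      { toFun := fun g ω => g ⟨upNum ω.1, hlt ω⟩ * ψ ω
        map_add' := fun g h => funext fun ω => add_mul _ _ _
        map_smul' := fun c g => funext fun ω => mul_assoc _ _ _ }
    have hinj : Function.Injective L := by
      intro g h hgh
      funext m
      obtain ⟨ω, hω⟩ := hsector m.1 (Nat.lt_succ_iff.mp m.2)
      have := mul_right_cancel₀ (hψ ω).ne' (congrFun hgh ω)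
      simpa only [hω] using this
    have hrange : LinearMap.range L =
        Module.End.eigenspace (limUVHam Ns Ne t t').mulVecLin E := by
      ext Φ
      rw [Module.End.mem_eigenspace_iff, Matrix.mulVecLin_apply, LinearMap.mem_range]
      constructor
      · rintro ⟨g, rfl⟩
        have := mulVec_mul_upNum hE fun m => if h : m < Ne + 1 then g ⟨m, h⟩ else 0
        simp only [hlt, dif_pos] at this
        exact this
      · intro hΦ
        choose c hc using fun m : Fin (Ne + 1) => hsector m.1 (Nat.lt_succ_iff.mp m.2)
        refine ⟨fun m => Φ (c m) / ψ (c m), funext fun ω => ?_⟩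
        change Φ (c ⟨upNum ω.1, hlt ω⟩) / ψ (c ⟨upNum ω.1, hlt ω⟩) * ψ ω = Φ ω
        rw [hratio Φ hΦ _ ω (hc ⟨upNum ω.1, hlt ω⟩), div_mul_cancel₀ _ (hψ ω).ne']
    rw [← hrange, LinearMap.finrank_range_of_inj hinj, Module.finrank_fin_fun]
end

section
/- Let d ≥ 1 and L ≥ 2 be integers, let V = (ℤ/Lℤ)^d (the set of external sites) and B = V × {1,...,d} (the set of internal sites, one at the midpoint of each bond of the hypercubic lattice, the bond b = (u,μ) joining u and u + e_μ), and let Λ = V ⊔ B. Let t > 0 and λ > 0, and for each b = (u,μ) ∈ B define λ^{(b)} ∈ ℝ^Λ by: λ^{(b)} has value λ at the internal site b, value 1 at the two external sites u and u + e_μ, and 0 elsewhere. Define the Λ×Λ matrix T = t Σ_{b∈B} λ^{(b)} (λ^{(b)})^T. For each y ∈ V define φ^{(y)} ∈ ℝ^Λ by: φ^{(y)} has value λ at y, value −1 at each of the 2d internal sites of the bonds containing y, and 0 elsewhere. Then T is symmetric positive semidefinite, Tφ^{(y)} = 0 for every y ∈ V, the L^d vectors {φ^{(y)} : y ∈ V}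 are linearly independent, and they span the kernel of T; in particular 0 is the lowest eigenvalue of T and the single-electron ground states are exactly L^d-fold degenerate. -/
/-- External sites of the `d`-dimensional decorated hypercubic lattice: the hypercubic
lattice `(ℤ/Lℤ)^d` itself. -/
abbrev ExtSite (d L : ℕ) := Fin d → ZMod L

/-- Internal sites: one at the midpoint of each bond `b = (u, μ)`, the bond joining `u`
and `u + e_μ`. -/
abbrev IntSite (d L : ℕ) := (Fin d → ZMod L) × Fin d

/-- The full decorated hypercubic lattice: external sites together with internal
(decorating) sites. -/
abbrev DecoratedSite (d L : ℕ) := ExtSite d L ⊕ IntSite d L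

/-- The unit vector `e_μ` of `(ℤ/Lℤ)^d`. -/
def unitVec (d L : ℕ) (μ : Fin d) : Fin d → ZMod L :=
  fun ν => if ν = μ then 1 else 0

/-- The cell vector `λ^{(b)}` of the triangular cell attached to the bond `b = (u, μ)`:
value `λ` at the internal site `b`, value `1` at the two external sites `u` and
`u + e_μ`, and `0` elsewhere. -/
def cellVec (d L : ℕ) [NeZero L] (lam : ℝ)
    (b : IntSite d L) : DecoratedSite d L → ℝ :=
  fun z =>
    match z with
    | Sum.inl u => if u = b.1 ∨ u = b.1 + unitVec d L b.2 then 1 else 0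
    | Sum.inr b' => if b' = b then lam else 0

/-- The flat-band hopping matrix `T = t ∑_b λ^{(b)} (λ^{(b)})ᵀ` of the decorated
hypercubic lattice (cell construction of Section 6.1-6.2). -/
def decoratedHopping (d L : ℕ) [NeZero L]
    (t lam : ℝ) : Matrix (DecoratedSite d L) (DecoratedSite d L) ℝ :=
  fun z w => t * ∑ b : IntSite d L, cellVec d L lam b z * cellVec d L lam b w

/-- The localized single-electron ground state `φ^{(y)}` (equation (6.8)): value `λ` at
the external site `y`, value `-1` at each of the `2d` internal sites of the bonds
containing `y`, and `0` elsewhere. -/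
def decoratedLocState (d L : ℕ) [NeZero L] (lam : ℝ)
    (y : ExtSite d L) : DecoratedSite d L → ℝ :=
  fun z =>
    match z with
    | Sum.inl u => if u = y then lam else 0
    | Sum.inr b => if b.1 = y ∨ b.1 + unitVec d L b.2 = y then -1 else 0

theorem unitVec_ne_zero {d L : ℕ} (hL : 2 ≤ L) (μ : Fin d) : unitVec d L μ ≠ 0 := by
  intro h
  have : Fact (1 < L) := ⟨hL⟩
  have h1 := congrFun h μ
  simp [unitVec] at h1

theorem Finset.sum_ite_eq_or_mul {ι R : Type*} [Fintype ι] [DecidableEq ι] [CommRing R]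
    {a b : ι} (hab : a ≠ b) (c : R) (f : ι → R) :
    ∑ y, (if y = a ∨ y = b then c else 0) * f y = c * (f a + f b) := by
  have h : ∀ y, (if y = a ∨ y = b then c else 0) * f y
      = (if y = a then c * f y else 0) + (if y = b then c * f y else 0) := by
    intro y
    by_cases h1 : y = a
    · subst h1
      simp [hab]
    · simp [h1]
  simp [h, Finset.sum_add_distrib, mul_add]

section

variable {d L : ℕ} [NeZero L]

theorem cellVec_dotProduct (hL : 2 ≤ L) (lam : ℝ) (b : IntSite d L)
    (v : DecoratedSite d L → ℝ) :
    cellVec d L lam b ⬝ᵥ v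
      = v (Sum.inl b.1) + v (Sum.inl (b.1 + unitVec d L b.2)) + lam * v (Sum.inr b) := by
  have hne : b.1 ≠ b.1 + unitVec d L b.2 := by
    simpa using unitVec_ne_zero hL b.2
  have h := Finset.sum_ite_eq_or_mul hne (1 : ℝ) (fun y => v (Sum.inl y))
  rw [dotProduct, Fintype.sum_sum_type]
  simp only [cellVec]
  rw [h]
  simp

theorem decoratedHopping_mulVec (t lam : ℝ) (v : DecoratedSite d L → ℝ)
    (z : DecoratedSite d L) :
    (decoratedHopping d L t lam).mulVec v z
      = t * ∑ b, cellVec d L lam b z * (cellVec d L lam b ⬝ᵥ v) := by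
  simp only [Matrix.mulVec, dotProduct, decoratedHopping, Finset.mul_sum, Finset.sum_mul]
  rw [Finset.sum_comm]
  refine Finset.sum_congr rfl fun b _ => Finset.sum_congr rfl fun w _ => ?_
  ring

theorem decoratedHopping_mulVec_eq_zero_iff {t lam : ℝ} (ht : t ≠ 0) (hlam : lam ≠ 0)
    (v : DecoratedSite d L → ℝ) :
    (decoratedHopping d L t lam).mulVec v = 0 ↔ ∀ b, cellVec d L lam b ⬝ᵥ v = 0 := by
  constructor
  · intro h b
    have hb := congrFun h (Sum.inr b)
    rw [decoratedHopping_mulVec] at hb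
    simpa [cellVec, ht, hlam] using hb
  · intro h
    ext z
    simp [decoratedHopping_mulVec, h]

theorem decoratedHopping_posSemidef {t : ℝ} (ht : 0 ≤ t) (lam : ℝ) :
    (decoratedHopping d L t lam).PosSemidef := by
  have h : decoratedHopping d L t lam
      = t • ∑ b, Matrix.vecMulVec (cellVec d L lam b) (star (cellVec d L lam b)) := by
    ext z w
    simp [decoratedHopping, Matrix.sum_apply, Matrix.vecMulVec_apply]
  rw [h]
  exact (Matrix.posSemidef_sum _ fun b _ => Matrix.posSemidef_vecMulVec_self_star _).smul ht

theorem cellVec_dotProduct_decoratedLocState (hL : 2 ≤ L) (lam : ℝ) (b : IntSite d L)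
    (y : ExtSite d L) : cellVec d L lam b ⬝ᵥ decoratedLocState d L lam y = 0 := by
  have hne : unitVec d L b.2 ≠ 0 := unitVec_ne_zero hL b.2
  rw [cellVec_dotProduct hL]
  simp only [decoratedLocState]
  by_cases h1 : b.1 = y
  · subst h1
    simp [hne]
  · by_cases h2 : b.1 + unitVec d L b.2 = y <;> simp [h1, h2]

theorem sum_smul_decoratedLocState_inl (lam : ℝ) (c : ExtSite d L → ℝ) (u : ExtSite d L) :
    (∑ y, c y • decoratedLocState d L lam y) (Sum.inl u) = c u * lam := by
  simp [Finset.sum_apply, decoratedLocState]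

theorem linearIndependent_decoratedLocState {lam : ℝ} (hlam : lam ≠ 0) :
    LinearIndependent ℝ (decoratedLocState d L lam) := by
  rw [Fintype.linearIndependent_iff]
  intro c hc u
  have h := congrFun hc (Sum.inl u)
  rw [sum_smul_decoratedLocState_inl] at h
  simpa [hlam] using h

theorem eq_sum_smul_decoratedLocState (hL : 2 ≤ L) {lam : ℝ} (hlam : lam ≠ 0)
    {v : DecoratedSite d L → ℝ} (hv : ∀ b, cellVec d L lam b ⬝ᵥ v = 0) :
    v = ∑ y, (v (Sum.inl y) / lam) • decoratedLocState d L lam y := by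
  set w := ∑ y, (v (Sum.inl y) / lam) • decoratedLocState d L lam y with hw
  have hinl : ∀ u, w (Sum.inl u) = v (Sum.inl u) := by
    intro u
    rw [hw, sum_smul_decoratedLocState_inl, div_mul_cancel₀ _ hlam]
  have hcell : ∀ b, cellVec d L lam b ⬝ᵥ w = 0 := by
    intro b
    simp [hw, dotProduct_sum, cellVec_dotProduct_decoratedLocState hL]
  ext z
  rcases z with u | b
  · exact (hinl u).symm
  · have h1 := hv b
    have h2 := hcell b
    rw [cellVec_dotProduct hL] at h1 h2
    rw [hinl, hinl] at h2
    exact mul_left_cancel₀ hlam (by linarith)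

end

/-- Single-electron problem of the flat-band Hubbard model on the `d`-dimensional
decorated hypercubic lattice (Section 6.2-6.3): the hopping matrix `T` is symmetric
positive semidefinite, the `L^d` localized states `φ^{(y)}` are zero-energy states,
are linearly independent and span the kernel of `T`; in particular `0` is the lowest
eigenvalue of `T` and the single-electron ground states are exactly `L^d`-fold
degenerate. -/
theorem decoratedHypercubic_flatBand
    (d L : ℕ) [NeZero L]
    (hd : 1 ≤ d) (hL : 2 ≤ L) (t lam : ℝ) (ht : 0 < t) (hlam : 0 < lam) :
    (decoratedHopping d L t lam).IsSymm ∧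
    (decoratedHopping d L t lam).PosSemidef ∧
    (∀ y : ExtSite d L,
      (decoratedHopping d L t lam).mulVec (decoratedLocState d L lam y) = 0) ∧
    LinearIndependent ℝ (decoratedLocState d L lam) ∧
    Submodule.span ℝ (Set.range (decoratedLocState d L lam)) =
      LinearMap.ker (decoratedHopping d L t lam).mulVecLin ∧
    Module.finrank ℝ (LinearMap.ker (decoratedHopping d L t lam).mulVecLin) = L ^ d := by
  have hker := decoratedHopping_mulVec_eq_zero_iff (d := d) (L := L) ht.ne' hlam.ne'
  have hpsd := decoratedHopping_posSemidef (d := d) (L := L) ht.le lam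
  have hzero : ∀ y : ExtSite d L,
      (decoratedHopping d L t lam).mulVec (decoratedLocState d L lam y) = 0 := fun y =>
    (hker _).2 fun b => cellVec_dotProduct_decoratedLocState hL lam b y
  have hli := linearIndependent_decoratedLocState (d := d) (L := L) hlam.ne'
  have hspan : Submodule.span ℝ (Set.range (decoratedLocState d L lam)) =
      LinearMap.ker (decoratedHopping d L t lam).mulVecLin := by
    apply le_antisymm
    · rw [Submodule.span_le]
      rintro _ ⟨y, rfl⟩
      exact hzero y
    · intro v hv
      rw [eq_sum_smul_decoratedLocState hL hlam.ne' ((hker v).1 hv)]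
      exact Submodule.sum_mem _ fun y _ =>
        Submodule.smul_mem _ _ (Submodule.subset_span ⟨y, rfl⟩)
  refine ⟨hpsd.isHermitian, hpsd, hzero, hli, hspan, ?_⟩
  rw [← hspan, finrank_span_eq_card hli]
  simp [ZMod.card]
end
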